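/- arXiv:cs/0702115 — 11 statements merged into one kernel-verified Lean document; each statement's English description precedes it below -/
import Mathlib

section
/- Let G be a guessing function on a finite set 𝕏, with c = ∑_{i=1}^{|𝕏|} 1/i, associated PMF Q_G(x) = (c·G(x))^{-1}, and associated length function L_G(x) = ⌈−log₂ Q_G(x)⌉. Then for every x ∈ 𝕏: (i) G(x) = c^{-1}·Q_G(x)^{-1} ≤ Q_G(x)^{-1}, and (ii) L_G(x) − 1 − log₂ c ≤ log₂ G(x) ≤ L_G(x). Moreover L_G satisfies Kraft's inequality ∑_{x∈𝕏} 2^{−L_G(x)} ≤ 1. -/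
/-!
STATEMENT 0: For a guessing function `G` on a finite set `𝕏` (a bijection onto
`{1, …, |𝕏|}`), with `c = ∑_{i=1}^{|𝕏|} 1/i`, associated PMF `Q_G x = (c · G x)⁻¹`
and associated length function `L_G x = ⌈-log₂ (Q_G x)⌉`, we have for every `x`:
`G x = c⁻¹ · (Q_G x)⁻¹ ≤ (Q_G x)⁻¹` and
`L_G x - 1 - log₂ c ≤ log₂ (G x) ≤ L_G x`,
and moreover `L_G` satisfies Kraft's inequality `∑_x 2^{-L_G x} ≤ 1`.
-/
theorem stmt_0 {𝕏 : Type*} [Fintype 𝕏] [Nonempty 𝕏]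
    (G : 𝕏 → ℕ)
    (hG : Set.BijOn G Set.univ (Set.Icc 1 (Fintype.card 𝕏)))
    (c : ℝ) (hc : c = ∑ i ∈ Finset.Icc 1 (Fintype.card 𝕏), (1 : ℝ) / i)
    (Q : 𝕏 → ℝ) (hQ : ∀ x, Q x = (c * (G x : ℝ))⁻¹)
    (L : 𝕏 → ℤ) (hL : ∀ x, L x = ⌈-Real.logb 2 (Q x)⌉) :
    (∀ x : 𝕏,
      ((G x : ℝ) = c⁻¹ * (Q x)⁻¹ ∧ (G x : ℝ) ≤ (Q x)⁻¹) ∧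
      ((L x : ℝ) - 1 - Real.logb 2 c ≤ Real.logb 2 (G x) ∧
        Real.logb 2 (G x) ≤ (L x : ℝ))) ∧
    ∑ x : 𝕏, (2 : ℝ) ^ (-(L x)) ≤ 1 := by
  have hpos : ∀ x, (1 : ℝ) ≤ G x := fun x => by
    have := (hG.mapsTo (Set.mem_univ x)).1
    exact_mod_cast this
  have hc1 : 1 ≤ c := by
    rw [hc]
    have h1 : 1 ∈ Finset.Icc 1 (Fintype.card 𝕏) :=
      Finset.mem_Icc.2 ⟨le_refl _, Fintype.card_pos⟩
    have := Finset.single_le_sum (f := fun i : ℕ => (1 : ℝ) / i)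
      (fun i _ => by positivity) h1
    simpa using this
  have hc0 : 0 < c := by linarith
  have hG0 : ∀ x, (0 : ℝ) < G x := fun x => by linarith [hpos x]
  have hlog : ∀ x, -Real.logb 2 (Q x) = Real.logb 2 c + Real.logb 2 (G x) := fun x => by
    rw [hQ, Real.logb_inv, neg_neg, Real.logb_mul hc0.ne' (hG0 x).ne']
  have hlc : 0 ≤ Real.logb 2 c := Real.logb_nonneg (by norm_num) hc1
  refine ⟨fun x => ⟨⟨?_, ?_⟩, ?_, ?_⟩, ?_⟩
  · rw [hQ, inv_inv, inv_mul_cancel_left₀ hc0.ne']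
  · rw [hQ, inv_inv]
    nlinarith [hG0 x]
  · have := Int.ceil_lt_add_one (-Real.logb 2 (Q x))
    rw [← hL, hlog] at this
    linarith
  · have := Int.le_ceil (-Real.logb 2 (Q x))
    rw [← hL, hlog] at this
    linarith
  · have hle : ∀ x, (2 : ℝ) ^ (-(L x)) ≤ Q x := fun x => by
      have hQ0 : 0 < Q x := by
        rw [hQ]
        exact inv_pos.2 (mul_pos hc0 (hG0 x))
      have := Int.le_ceil (-Real.logb 2 (Q x))
      rw [← hL] at this
      rw [← Real.rpow_intCast, ← Real.le_logb_iff_rpow_le (by norm_num) hQ0]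
      push_cast
      linarith
    have hsum : ∑ x : 𝕏, (1 : ℝ) / (G x : ℝ) = c := by
      rw [hc]
      refine Finset.sum_bij (fun x _ => G x) ?_ ?_ ?_ ?_
      · intro x _
        exact Finset.mem_Icc.2 (hG.mapsTo (Set.mem_univ x))
      · intro x _ y _ h
        exact hG.injOn (Set.mem_univ x) (Set.mem_univ y) h
      · intro i hi
        obtain ⟨x, _, hx⟩ := hG.surjOn (Finset.mem_Icc.1 hi)
        exact ⟨x, Finset.mem_univ x, hx⟩
      · intro x _
        rfl
    calc ∑ x : 𝕏, (2 : ℝ) ^ (-(L x)) ≤ ∑ x : 𝕏, Q x := Finset.sum_le_sum fun x _ => hle x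
      _ = c⁻¹ * ∑ x : 𝕏, (1 : ℝ) / (G x : ℝ) := by
        rw [Finset.mul_sum]
        refine Finset.sum_congr rfl fun x _ => ?_
        rw [hQ, mul_inv, one_div]
      _ = 1 := by rw [hsum, inv_mul_cancel₀ hc0.ne']
      _ ≤ 1 := le_refl _
end

section
/- Let L be a length function on a finite set 𝕏, with associated PMF Q_L(x) = 2^{−L(x)} / ∑_{a∈𝕏} 2^{−L(a)} and associated guessing function G_L that guesses in increasing order of L-values (ties broken by a fixed order). Then (i) G_L guesses messages in decreasing order of Q_L-probabilities, and (ii) for every x ∈ 𝕏, log₂ G_L(x) ≤ log₂ Q_L(x)^{-1} ≤ L(x), i.e., G_L(x) ≤ Q_L(x)^{-1} ≤ 2^{L(x)}. -/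
/-!
STATEMENT 1: For a length function `L` on a finite set `𝕏` (satisfying Kraft's
inequality), with associated PMF `Q_L x = 2^{-L x} / ∑_a 2^{-L a}` and associated
guessing function `G_L` (a bijection onto `{1, …, |𝕏|}` guessing in increasing
order of `L`-values), we have:
(i) `G_L` guesses in decreasing order of `Q_L`-probabilities, and
(ii) for every `x`, `G_L x ≤ (Q_L x)⁻¹ ≤ 2^{L x}`
(equivalently, `log₂ G_L(x) ≤ log₂ Q_L(x)⁻¹ ≤ L x`).
-/
theorem stmt_1 {𝕏 : Type*} [Fintype 𝕏] [Nonempty 𝕏]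
    (L : 𝕏 → ℕ) (hKraft : ∑ x : 𝕏, (2 : ℝ) ^ (-(L x : ℤ)) ≤ 1)
    (Q : 𝕏 → ℝ)
    (hQ : ∀ x, Q x = (2 : ℝ) ^ (-(L x : ℤ)) / ∑ a : 𝕏, (2 : ℝ) ^ (-(L a : ℤ)))
    (G_L : 𝕏 → ℕ)
    (hG_L : Set.BijOn G_L Set.univ (Set.Icc 1 (Fintype.card 𝕏)))
    (hG_Lord : ∀ x x', L x < L x' → G_L x < G_L x') :
    (∀ x x' : 𝕏, G_L x ≤ G_L x' → Q x' ≤ Q x) ∧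
    (∀ x : 𝕏, (G_L x : ℝ) ≤ (Q x)⁻¹ ∧ (Q x)⁻¹ ≤ (2 : ℝ) ^ (L x)) := by
  classical
  have hpos : ∀ x, (0 : ℝ) < (2 : ℝ) ^ (-(L x : ℤ)) := fun x => by positivity
  have hS : 0 < ∑ a : 𝕏, (2 : ℝ) ^ (-(L a : ℤ)) :=
    Finset.sum_pos (fun a _ => hpos a) Finset.univ_nonempty
  have hmono : ∀ x x' : 𝕏, G_L x ≤ G_L x' →
      (2 : ℝ) ^ (-(L x' : ℤ)) ≤ (2 : ℝ) ^ (-(L x : ℤ)) := by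
    intro x x' h
    have hL : L x ≤ L x' := by
      by_contra hc
      have := hG_Lord x' x (by omega)
      omega
    exact zpow_le_zpow_right₀ (by norm_num) (by omega)
  refine ⟨fun x x' h => ?_, fun x => ⟨?_, ?_⟩⟩
  · rw [hQ, hQ]
    exact div_le_div_of_nonneg_right (hmono x x' h) hS.le
  · rw [hQ, inv_div, le_div_iff₀ (hpos x)]
    have hx := hG_L.mapsTo (Set.mem_univ x)
    have himg : Finset.Icc 1 (G_L x) ⊆
        (Finset.univ.filter (fun y => G_L y ≤ G_L x)).image G_L := by
      intro k hk
      rw [Finset.mem_Icc] at hk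
      obtain ⟨y, _, hy⟩ := hG_L.surjOn
        (show k ∈ Set.Icc 1 (Fintype.card 𝕏) from ⟨hk.1, hk.2.trans hx.2⟩)
      rw [Finset.mem_image]
      exact ⟨y, by simp [hy, hk.2], hy⟩
    have hcard : G_L x ≤ (Finset.univ.filter (fun y => G_L y ≤ G_L x)).card := by
      have := (Finset.card_le_card himg).trans Finset.card_image_le
      simpa using this
    calc (G_L x : ℝ) * (2 : ℝ) ^ (-(L x : ℤ))
        ≤ ((Finset.univ.filter (fun y => G_L y ≤ G_L x)).card : ℝ) * (2 : ℝ) ^ (-(L x : ℤ)) :=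
          mul_le_mul_of_nonneg_right (by exact_mod_cast hcard) (hpos x).le
      _ ≤ ∑ y ∈ Finset.univ.filter (fun y => G_L y ≤ G_L x), (2 : ℝ) ^ (-(L y : ℤ)) := by
          rw [← nsmul_eq_mul]
          refine Finset.card_nsmul_le_sum _ _ _ (fun y hy => ?_)
          exact hmono y x (Finset.mem_filter.mp hy).2
      _ ≤ ∑ a : 𝕏, (2 : ℝ) ^ (-(L a : ℤ)) :=
          Finset.sum_le_sum_of_subset_of_nonneg (Finset.filter_subset _ _)
            (fun a _ _ => (hpos a).le)
  · rw [hQ, inv_div, div_le_iff₀ (hpos x), zpow_neg, zpow_natCast,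
      mul_inv_cancel₀ (by positivity)]
    exact hKraft
end

section
/- Let 𝕏 be a finite set and B ≥ 1. (i) For any guessing function G on 𝕏 with associated length function L_G(x) = ⌈−log₂((c·G(x))^{-1})⌉ where c = ∑_{i=1}^{|𝕏|} 1/i, the following set inclusions hold: {x : L_G(x) ≥ B + 1 + log₂ c} ⊆ {x : G(x) ≥ 2^B} ⊆ {x : L_G(x) ≥ B}. (ii) For any length function L on 𝕏 with associated guessing function G_L, one has {x : G_L(x) ≥ 2^B} ⊆ {x : L(x) ≥ B}. -/
/-!
STATEMENT 2: Let `𝕏` be a finite set and `B ≥ 1`.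
(i) For a guessing function `G` (bijection onto `{1,…,|𝕏|}`) with associated
length function `L_G x = ⌈-log₂ ((c · G x)⁻¹)⌉` where `c = ∑_{i=1}^{|𝕏|} 1/i`:
`{x : L_G x ≥ B + 1 + log₂ c} ⊆ {x : G x ≥ 2^B} ⊆ {x : L_G x ≥ B}`.
(ii) For a length function `L` (Kraft) with associated guessing function `G_L`
(guessing in increasing order of `L`-values):
`{x : G_L x ≥ 2^B} ⊆ {x : L x ≥ B}`.
-/
theorem stmt_2 {𝕏 : Type*} [Fintype 𝕏] [Nonempty 𝕏]
    (c : ℝ) (hc : c = ∑ i ∈ Finset.Icc 1 (Fintype.card 𝕏), (1 : ℝ) / i)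
    (B : ℝ) (hB : 1 ≤ B)
    -- part (i) data: a guessing function and its associated length function
    (G : 𝕏 → ℕ) (hG : Set.BijOn G Set.univ (Set.Icc 1 (Fintype.card 𝕏)))
    (L_G : 𝕏 → ℤ) (hL_G : ∀ x, L_G x = ⌈-Real.logb 2 ((c * (G x : ℝ))⁻¹)⌉)
    -- part (ii) data: a length function and its associated guessing function
    (L : 𝕏 → ℕ) (hKraft : ∑ x : 𝕏, (2 : ℝ) ^ (-(L x : ℤ)) ≤ 1)
    (G_L : 𝕏 → ℕ) (hG_L : Set.BijOn G_L Set.univ (Set.Icc 1 (Fintype.card 𝕏)))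
    (hG_Lord : ∀ x x', L x < L x' → G_L x < G_L x') :
    ({x : 𝕏 | B + 1 + Real.logb 2 c ≤ (L_G x : ℝ)} ⊆
        {x : 𝕏 | (2 : ℝ) ^ B ≤ (G x : ℝ)} ∧
      {x : 𝕏 | (2 : ℝ) ^ B ≤ (G x : ℝ)} ⊆ {x : 𝕏 | B ≤ (L_G x : ℝ)}) ∧
    {x : 𝕏 | (2 : ℝ) ^ B ≤ (G_L x : ℝ)} ⊆ {x : 𝕏 | B ≤ (L x : ℝ)} := by
  have hc1 : 1 ≤ c := by
    rw [hc]
    have h := Finset.single_le_sum (s := Finset.Icc 1 (Fintype.card 𝕏))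
      (f := fun i : ℕ => (1 : ℝ) / i) (fun i _ => by positivity)
      (Finset.mem_Icc.2 ⟨le_refl 1, Fintype.card_pos⟩)
    simpa using h
  have hG1 : ∀ x, (1 : ℝ) ≤ G x := fun x => by
    exact_mod_cast (hG.mapsTo (Set.mem_univ x)).1
  have hval : ∀ x, -Real.logb 2 ((c * (G x : ℝ))⁻¹) = Real.logb 2 c + Real.logb 2 (G x) := by
    intro x
    have := hG1 x
    rw [Real.logb_inv, neg_neg, Real.logb_mul (by linarith) (by linarith)]
  have hlc : 0 ≤ Real.logb 2 c := Real.logb_nonneg (by norm_num) hc1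
  have hiff : ∀ x, (2 : ℝ) ^ B ≤ (G x : ℝ) ↔ B ≤ Real.logb 2 (G x) := fun x =>
    (Real.le_logb_iff_rpow_le (by norm_num) (by linarith [hG1 x])).symm
  refine ⟨⟨?_, ?_⟩, ?_⟩
  · intro x hx
    simp only [Set.mem_setOf_eq] at hx ⊢
    rw [hiff]
    have h := Int.ceil_lt_add_one (-Real.logb 2 ((c * (G x : ℝ))⁻¹))
    rw [← hL_G x, hval] at h
    linarith
  · intro x hx
    simp only [Set.mem_setOf_eq] at hx ⊢
    rw [hiff] at hx
    have h := Int.le_ceil (-Real.logb 2 ((c * (G x : ℝ))⁻¹))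
    rw [← hL_G x, hval] at h
    linarith
  · intro x hx
    simp only [Set.mem_setOf_eq] at hx ⊢
    classical
    have hxm := hG_L.mapsTo (Set.mem_univ x)
    have hcard : G_L x ≤ (Finset.univ.filter (fun y => G_L y ≤ G_L x)).card := by
      have hsub : Finset.Icc 1 (G_L x) ⊆
          (Finset.univ.filter (fun y => G_L y ≤ G_L x)).image G_L := by
        intro n hn
        rw [Finset.mem_Icc] at hn
        obtain ⟨y, -, hy⟩ := hG_L.surjOn (show n ∈ Set.Icc 1 (Fintype.card 𝕏) from
          ⟨hn.1, hn.2.trans hxm.2⟩)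
        exact Finset.mem_image.2 ⟨y, by simp [hy, hn.2], hy⟩
      have h := (Finset.card_le_card hsub).trans Finset.card_image_le
      simpa using h
    have hsum : (G_L x : ℝ) * (2 : ℝ) ^ (-(L x : ℤ)) ≤ 1 := by
      calc (G_L x : ℝ) * (2 : ℝ) ^ (-(L x : ℤ))
          ≤ ((Finset.univ.filter (fun y => G_L y ≤ G_L x)).card : ℝ) * (2 : ℝ) ^ (-(L x : ℤ)) := by
            gcongr
        _ = ∑ y ∈ Finset.univ.filter (fun y => G_L y ≤ G_L x), (2 : ℝ) ^ (-(L x : ℤ)) := by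
            rw [Finset.sum_const, nsmul_eq_mul]
        _ ≤ ∑ y ∈ Finset.univ.filter (fun y => G_L y ≤ G_L x), (2 : ℝ) ^ (-(L y : ℤ)) := by
            refine Finset.sum_le_sum fun y hy => ?_
            have hy' : G_L y ≤ G_L x := by simpa using hy
            have hL : L y ≤ L x := by
              by_contra hlt
              have := hG_Lord x y (not_le.1 hlt)
              omega
            exact zpow_le_zpow_right₀ (by norm_num) (by omega)
        _ ≤ ∑ y, (2 : ℝ) ^ (-(L y : ℤ)) :=
            Finset.sum_le_sum_of_subset_of_nonneg (Finset.filter_subset _ _)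
              (fun _ _ _ => by positivity)
        _ ≤ 1 := hKraft
    rw [zpow_neg, zpow_natCast, ← div_eq_mul_inv, div_le_one (by positivity)] at hsum
    have h2 : (2 : ℝ) ^ B ≤ (2 : ℝ) ^ (L x : ℝ) := by
      rw [Real.rpow_natCast]
      exact hx.trans hsum
    exact (Real.rpow_le_rpow_left_iff (by norm_num)).1 h2
end

section
/- Let P be a PMF on a finite set 𝕏, ρ > 0, c = ∑_{i=1}^{|𝕏|} 1/i. Let L be any length function on 𝕏 with associated guessing function G_L, let L* be a length function minimizing E[2^{ρ L*(X)}] over all length functions, and let G* be a guessing function ordering 𝕏 in decreasing order of P-probabilities (so G* minimizes E[G(X)^ρ] over all guessing functions). Then E[G_L(X)^ρ] / E[G*(X)^ρ] ≤ (E[2^{ρ L(X)}] / E[2^{ρ L*(X)}]) · 2^{ρ(1 + log₂ c)}, where all expectations are with respect to P. -/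
/-!
STATEMENT 3: Let `P` be a PMF on a finite set `𝕏`, `ρ > 0`, `c = ∑_{i=1}^{|𝕏|} 1/i`.
Let `L` be any length function with associated guessing function `G_L`, let `L*`
minimize `E[2^{ρ L(X)}]` over length functions, and let `G*` guess in decreasing
order of `P`-probabilities. Then
`E[G_L(X)^ρ] / E[G*(X)^ρ] ≤ (E[2^{ρ L(X)}] / E[2^{ρ L*(X)}]) · 2^{ρ(1 + log₂ c)}`.
-/
theorem stmt_3 {𝕏 : Type*} [Fintype 𝕏] [Nonempty 𝕏]
    (P : 𝕏 → ℝ) (hP0 : ∀ x, 0 ≤ P x) (hP1 : ∑ x : 𝕏, P x = 1)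
    (ρ : ℝ) (hρ : 0 < ρ)
    (c : ℝ) (hc : c = ∑ i ∈ Finset.Icc 1 (Fintype.card 𝕏), (1 : ℝ) / i)
    -- a length function `L` and its associated guessing function `G_L`
    (L : 𝕏 → ℕ) (hKraft : ∑ x : 𝕏, (2 : ℝ) ^ (-(L x : ℤ)) ≤ 1)
    (G_L : 𝕏 → ℕ) (hG_L : Set.BijOn G_L Set.univ (Set.Icc 1 (Fintype.card 𝕏)))
    (hG_Lord : ∀ x x', L x < L x' → G_L x < G_L x')
    -- an optimal length function `L*`
    (Lstar : 𝕏 → ℕ) (hLstarKraft : ∑ x : 𝕏, (2 : ℝ) ^ (-(Lstar x : ℤ)) ≤ 1)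
    (hLstarMin : ∀ L' : 𝕏 → ℕ, (∑ x : 𝕏, (2 : ℝ) ^ (-(L' x : ℤ)) ≤ 1) →
      ∑ x : 𝕏, P x * (2 : ℝ) ^ (ρ * (Lstar x : ℝ)) ≤
        ∑ x : 𝕏, P x * (2 : ℝ) ^ (ρ * (L' x : ℝ)))
    -- an optimal guessing function `G*` (decreasing order of `P`-probabilities)
    (Gstar : 𝕏 → ℕ) (hGstar : Set.BijOn Gstar Set.univ (Set.Icc 1 (Fintype.card 𝕏)))
    (hGstarOrd : ∀ x x', Gstar x ≤ Gstar x' → P x' ≤ P x) :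
    (∑ x : 𝕏, P x * (G_L x : ℝ) ^ ρ) / (∑ x : 𝕏, P x * (Gstar x : ℝ) ^ ρ) ≤
      ((∑ x : 𝕏, P x * (2 : ℝ) ^ (ρ * (L x : ℝ))) /
          (∑ x : 𝕏, P x * (2 : ℝ) ^ (ρ * (Lstar x : ℝ)))) *
        (2 : ℝ) ^ (ρ * (1 + Real.logb 2 c)) := by
  have hG1 : ∀ x, G_L x ∈ Set.Icc 1 (Fintype.card 𝕏) := fun x => hG_L.1 (Set.mem_univ x)
  have hS1 : ∀ x, Gstar x ∈ Set.Icc 1 (Fintype.card 𝕏) := fun x => hGstar.1 (Set.mem_univ x)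
  have hS1' : ∀ x, (1 : ℝ) ≤ Gstar x := fun x => by exact_mod_cast (hS1 x).1
  have hcard : 1 ≤ Fintype.card 𝕏 := Fintype.card_pos
  have hc1 : 1 ≤ c := by
    rw [hc]
    have := Finset.single_le_sum (s := Finset.Icc 1 (Fintype.card 𝕏))
      (f := fun i : ℕ => (1 : ℝ) / i) (fun i _ => by positivity)
      (Finset.mem_Icc.2 ⟨le_refl 1, hcard⟩)
    simpa using this
  have hc0 : 0 < c := by linarith
  -- the guessing function is dominated by the length function
  have hGL : ∀ x, (G_L x : ℝ) ≤ (2 : ℝ) ^ (L x : ℝ) := by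
    intro x
    classical
    let S := Finset.univ.filter (fun y => G_L y ≤ G_L x)
    have hcS : G_L x ≤ S.card := by
      have h1 : Finset.Icc 1 (G_L x) ⊆ S.image G_L := by
        intro n hn
        rw [Finset.mem_Icc] at hn
        obtain ⟨y, _, hy⟩ := hG_L.2.2 (show n ∈ Set.Icc 1 (Fintype.card 𝕏) from
          ⟨hn.1, hn.2.trans (hG1 x).2⟩)
        exact Finset.mem_image.2 ⟨y, by simp [S, hy, hn.2], hy⟩
      have h2 := (Finset.card_le_card h1).trans Finset.card_image_le
      simpa using h2
    have h3 : (S.card : ℝ) * (2 : ℝ) ^ (-(L x : ℤ)) ≤ 1 := by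
      calc (S.card : ℝ) * (2 : ℝ) ^ (-(L x : ℤ)) = ∑ y ∈ S, (2 : ℝ) ^ (-(L x : ℤ)) := by simp
        _ ≤ ∑ y ∈ S, (2 : ℝ) ^ (-(L y : ℤ)) := by
          apply Finset.sum_le_sum
          intro y hy
          have hy' : G_L y ≤ G_L x := by simpa [S] using hy
          have hL : L y ≤ L x := by
            by_contra h
            have := hG_Lord x y (by omega)
            omega
          exact zpow_le_zpow_right₀ (by norm_num) (by omega)
        _ ≤ ∑ y, (2 : ℝ) ^ (-(L y : ℤ)) :=
          Finset.sum_le_sum_of_subset_of_nonneg (Finset.subset_univ _)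
            (fun _ _ _ => by positivity)
        _ ≤ 1 := hKraft
    have h4 : (G_L x : ℝ) ≤ S.card := by exact_mod_cast hcS
    rw [zpow_neg, zpow_natCast, ← div_eq_mul_inv, div_le_one (by positivity)] at h3
    rw [Real.rpow_natCast]
    exact h4.trans h3
  have hA : ∑ x : 𝕏, P x * (G_L x : ℝ) ^ ρ ≤ ∑ x : 𝕏, P x * (2 : ℝ) ^ (ρ * (L x : ℝ)) := by
    apply Finset.sum_le_sum
    intro x _
    apply mul_le_mul_of_nonneg_left _ (hP0 x)
    rw [mul_comm ρ, Real.rpow_mul (by norm_num)]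
    exact Real.rpow_le_rpow (by positivity) (hGL x) hρ.le
  -- the length function associated with the optimal guessing function
  have hge : ∀ x, 1 ≤ c * Gstar x := fun x => by nlinarith [hS1' x]
  let L' : 𝕏 → ℕ := fun x => ⌈Real.logb 2 (c * Gstar x)⌉₊
  have hsum : ∑ x, (1 : ℝ) / Gstar x = c := by
    rw [hc]
    refine Finset.sum_bij (fun x _ => Gstar x) ?_ ?_ ?_ ?_
    · intro x _
      exact Finset.mem_Icc.2 (hS1 x)
    · intro x _ y _ h
      exact hGstar.2.1 (Set.mem_univ x) (Set.mem_univ y) h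
    · intro n hn
      obtain ⟨y, _, hy⟩ := hGstar.2.2 (Finset.mem_Icc.1 hn)
      exact ⟨y, Finset.mem_univ y, hy⟩
    · intro x _
      rfl
  have hK' : ∑ x : 𝕏, (2 : ℝ) ^ (-(L' x : ℤ)) ≤ 1 := by
    calc ∑ x : 𝕏, (2 : ℝ) ^ (-(L' x : ℤ)) ≤ ∑ x, c⁻¹ * (1 / (Gstar x : ℝ)) := by
          apply Finset.sum_le_sum
          intro x _
          have h1 : Real.logb 2 (c * Gstar x) ≤ (L' x : ℝ) := Nat.le_ceil _
          rw [Real.logb_le_iff_le_rpow (by norm_num) (by linarith [hge x]),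
            Real.rpow_natCast] at h1
          rw [zpow_neg, zpow_natCast, one_div, ← mul_inv]
          exact inv_anti₀ (by linarith [hge x]) h1
      _ = 1 := by
          rw [← Finset.mul_sum, hsum]
          exact inv_mul_cancel₀ hc0.ne'
  have hconst : (2 : ℝ) ^ (ρ * (1 + Real.logb 2 c)) = (2 * c) ^ ρ := by
    rw [mul_comm ρ, Real.rpow_mul (by norm_num), Real.rpow_add (by norm_num), Real.rpow_one,
      Real.rpow_logb (by norm_num) (by norm_num) hc0]
  have hD : ∑ x : 𝕏, P x * (2 : ℝ) ^ (ρ * (Lstar x : ℝ)) ≤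
      (2 * c) ^ ρ * ∑ x : 𝕏, P x * (Gstar x : ℝ) ^ ρ := by
    refine (hLstarMin L' hK').trans ?_
    rw [Finset.mul_sum]
    apply Finset.sum_le_sum
    intro x _
    have h1 : (L' x : ℝ) ≤ Real.logb 2 (c * Gstar x) + 1 :=
      (Nat.ceil_lt_add_one (Real.logb_nonneg (by norm_num) (hge x))).le
    have h2 : (2 : ℝ) ^ (L' x : ℝ) ≤ 2 * c * Gstar x := by
      refine (Real.rpow_le_rpow_of_exponent_le (by norm_num) h1).trans ?_
      rw [Real.rpow_add (by norm_num), Real.rpow_one,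
        Real.rpow_logb (by norm_num) (by norm_num) (by linarith [hge x])]
      linarith
    have h3 : (2 : ℝ) ^ (ρ * (L' x : ℝ)) ≤ (2 * c) ^ ρ * (Gstar x : ℝ) ^ ρ := by
      rw [mul_comm ρ, Real.rpow_mul (by norm_num),
        ← Real.mul_rpow (by positivity) (by positivity)]
      exact Real.rpow_le_rpow (by positivity) h2 hρ.le
    calc _ ≤ P x * ((2 * c) ^ ρ * (Gstar x : ℝ) ^ ρ) := mul_le_mul_of_nonneg_left h3 (hP0 x)
      _ = _ := by ring
  have hpos : ∀ f : 𝕏 → ℝ, (∀ x, 1 ≤ f x) → 0 < ∑ x, P x * f x := by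
    intro f hf
    have : ∑ x, P x ≤ ∑ x, P x * f x :=
      Finset.sum_le_sum fun x _ => le_mul_of_one_le_right (hP0 x) (hf x)
    linarith
  have hB0 := hpos (fun x => (Gstar x : ℝ) ^ ρ) (fun x => Real.one_le_rpow (hS1' x) hρ.le)
  have hD0 := hpos (fun x => (2 : ℝ) ^ (ρ * (Lstar x : ℝ)))
    (fun x => Real.one_le_rpow (by norm_num) (by positivity))
  have hC0 : 0 ≤ ∑ x : 𝕏, P x * (2 : ℝ) ^ (ρ * (L x : ℝ)) :=
    Finset.sum_nonneg fun x _ => mul_nonneg (hP0 x) (by positivity)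
  rw [hconst, div_mul_eq_mul_div, div_le_div_iff₀ hB0 hD0, mul_assoc]
  exact mul_le_mul hA hD hD0.le hC0
end

section
/- Let P be a PMF on a finite set 𝕏, ρ > 0, c = ∑_{i=1}^{|𝕏|} 1/i. Let G be any guessing function on 𝕏 with associated length function L_G, let L* be a length function minimizing E[2^{ρ L*(X)}] over all length functions, and let G* be a guessing function ordering 𝕏 in decreasing order of P-probabilities. Then E[G(X)^ρ] / E[G*(X)^ρ] ≥ (E[2^{ρ L_G(X)}] / E[2^{ρ L*(X)}]) · 2^{−ρ(1 + log₂ c)}, where all expectations are with respect to P. -/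
theorem guess_le_length {𝕏 : Type*} [Fintype 𝕏]
    (P : 𝕏 → ℝ) (hP0 : ∀ x, 0 ≤ P x) (ρ : ℝ) (hρ : 0 < ρ)
    (L : 𝕏 → ℕ) (hL : ∑ x : 𝕏, (2 : ℝ) ^ (-(L x : ℤ)) ≤ 1)
    (g : 𝕏 → ℕ) (hg : Set.BijOn g Set.univ (Set.Icc 1 (Fintype.card 𝕏)))
    (hord : ∀ x x', g x ≤ g x' → P x' ≤ P x) :
    (∑ x : 𝕏, P x * (g x : ℝ) ^ ρ) ≤ ∑ x : 𝕏, P x * (2 : ℝ) ^ (ρ * (L x : ℝ)) := by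
  classical
  let e := Fintype.equivFin 𝕏
  let h : Fin (Fintype.card 𝕏) ≃ 𝕏 := (Tuple.sort (L ∘ e.symm)).trans e.symm
  have hmono : Monotone (L ∘ h) := Tuple.monotone_sort (L ∘ e.symm)
  have hk : ∀ i : Fin (Fintype.card 𝕏), ((i : ℕ) + 1 : ℝ) ≤ 2 ^ (L (h i)) := by
    intro i
    have h1 : ∑ j ∈ Finset.Iic i, (2 : ℝ) ^ (-(L (h i) : ℤ)) ≤ 1 := by
      calc _ ≤ ∑ j ∈ Finset.Iic i, (2 : ℝ) ^ (-(L (h j) : ℤ)) := by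
            apply Finset.sum_le_sum
            intro j hj
            have : L (h j) ≤ L (h i) := hmono (Finset.mem_Iic.mp hj)
            apply zpow_le_zpow_right₀ (by norm_num)
            omega
        _ ≤ ∑ j, (2 : ℝ) ^ (-(L (h j) : ℤ)) :=
            Finset.sum_le_univ_sum_of_nonneg fun j => by positivity
        _ = ∑ x : 𝕏, (2 : ℝ) ^ (-(L x : ℤ)) :=
            Equiv.sum_comp h fun x => (2 : ℝ) ^ (-(L x : ℤ))
        _ ≤ 1 := hL
    rw [Finset.sum_const, Fin.card_Iic, nsmul_eq_mul, zpow_neg, zpow_natCast,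
      mul_inv_le_iff₀ (by positivity), one_mul] at h1
    exact_mod_cast h1
  have hex : ∀ i : Fin (Fintype.card 𝕏), ∃ x, g x = i + 1 := by
    intro i
    obtain ⟨x, _, hx⟩ := hg.surjOn (show (i : ℕ) + 1 ∈ Set.Icc 1 (Fintype.card 𝕏) from
      ⟨by omega, by omega⟩)
    exact ⟨x, hx⟩
  choose u hu using hex
  have hub : Function.Bijective u := by
    rw [Fintype.bijective_iff_injective_and_card]
    refine ⟨fun i j hij => ?_, by simp⟩
    have h1 := hu i
    rw [hij, hu j] at h1
    exact Fin.ext (by omega)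
  let σ : Equiv.Perm 𝕏 := h.symm.trans (Equiv.ofBijective u hub)
  have hanti : Antivary P (fun x => (g x : ℝ) ^ ρ) := by
    intro x y hxy
    apply hord
    by_contra hlt
    push Not at hlt
    have : (g y : ℝ) ^ ρ ≤ (g x : ℝ) ^ ρ :=
      Real.rpow_le_rpow (by positivity) (by exact_mod_cast hlt.le) hρ.le
    exact absurd hxy (not_lt.mpr this)
  refine (hanti.sum_mul_le_sum_mul_comp_perm (σ := σ)).trans ?_
  apply Finset.sum_le_sum
  intro x _
  apply mul_le_mul_of_nonneg_left _ (hP0 x)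
  have h1 : g (σ x) = (h.symm x : ℕ) + 1 := hu (h.symm x)
  have h2 := hk (h.symm x)
  rw [Equiv.apply_symm_apply] at h2
  rw [h1, mul_comm, Real.rpow_mul (by norm_num), Real.rpow_natCast]
  apply Real.rpow_le_rpow (by positivity) _ hρ.le
  exact_mod_cast h2


/-!
STATEMENT 4: Let `P` be a PMF on a finite set `𝕏`, `ρ > 0`, `c = ∑_{i=1}^{|𝕏|} 1/i`.
Let `G` be any guessing function with associated length function
`L_G x = ⌈-log₂ ((c · G x)⁻¹)⌉`, let `L*` minimize `E[2^{ρ L(X)}]` over length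
functions, and let `G*` guess in decreasing order of `P`-probabilities. Then
`E[G(X)^ρ] / E[G*(X)^ρ] ≥ (E[2^{ρ L_G(X)}] / E[2^{ρ L*(X)}]) · 2^{-ρ(1 + log₂ c)}`.
-/
theorem stmt_4 {𝕏 : Type*} [Fintype 𝕏] [Nonempty 𝕏]
    (P : 𝕏 → ℝ) (hP0 : ∀ x, 0 ≤ P x) (hP1 : ∑ x : 𝕏, P x = 1)
    (ρ : ℝ) (hρ : 0 < ρ)
    (c : ℝ) (hc : c = ∑ i ∈ Finset.Icc 1 (Fintype.card 𝕏), (1 : ℝ) / i)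
    -- a guessing function `G` and its associated length function `L_G`
    (G : 𝕏 → ℕ) (hG : Set.BijOn G Set.univ (Set.Icc 1 (Fintype.card 𝕏)))
    (L_G : 𝕏 → ℤ) (hL_G : ∀ x, L_G x = ⌈-Real.logb 2 ((c * (G x : ℝ))⁻¹)⌉)
    -- an optimal length function `L*`
    (Lstar : 𝕏 → ℕ) (hLstarKraft : ∑ x : 𝕏, (2 : ℝ) ^ (-(Lstar x : ℤ)) ≤ 1)
    (hLstarMin : ∀ L' : 𝕏 → ℕ, (∑ x : 𝕏, (2 : ℝ) ^ (-(L' x : ℤ)) ≤ 1) →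
      ∑ x : 𝕏, P x * (2 : ℝ) ^ (ρ * (Lstar x : ℝ)) ≤
        ∑ x : 𝕏, P x * (2 : ℝ) ^ (ρ * (L' x : ℝ)))
    -- an optimal guessing function `G*` (decreasing order of `P`-probabilities)
    (Gstar : 𝕏 → ℕ) (hGstar : Set.BijOn Gstar Set.univ (Set.Icc 1 (Fintype.card 𝕏)))
    (hGstarOrd : ∀ x x', Gstar x ≤ Gstar x' → P x' ≤ P x) :
    (∑ x : 𝕏, P x * (G x : ℝ) ^ ρ) / (∑ x : 𝕏, P x * (Gstar x : ℝ) ^ ρ) ≥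
      ((∑ x : 𝕏, P x * (2 : ℝ) ^ (ρ * (L_G x : ℝ))) /
          (∑ x : 𝕏, P x * (2 : ℝ) ^ (ρ * (Lstar x : ℝ)))) *
        (2 : ℝ) ^ (-ρ * (1 + Real.logb 2 c)) := by
  have hG1 : ∀ x, 1 ≤ G x := fun x => (hG.mapsTo (Set.mem_univ x)).1
  have hS1 : ∀ x, 1 ≤ Gstar x := fun x => (hGstar.mapsTo (Set.mem_univ x)).1
  have hc0 : 0 < c := by
    rw [hc]
    apply Finset.sum_pos
    · intro i hi
      have : 1 ≤ i := (Finset.mem_Icc.mp hi).1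
      positivity
    · exact ⟨1, Finset.mem_Icc.mpr ⟨le_rfl, Fintype.card_pos⟩⟩
  have hA : (∑ x : 𝕏, P x * (2 : ℝ) ^ (ρ * (L_G x : ℝ))) * (2 : ℝ) ^ (-ρ * (1 + Real.logb 2 c))
      ≤ ∑ x : 𝕏, P x * (G x : ℝ) ^ ρ := by
    rw [Finset.sum_mul]
    apply Finset.sum_le_sum
    intro x _
    rw [mul_assoc, ← Real.rpow_add (by norm_num)]
    apply mul_le_mul_of_nonneg_left _ (hP0 x)
    have hg : (0 : ℝ) < G x := by exact_mod_cast hG1 x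
    have h1 : (L_G x : ℝ) < -Real.logb 2 ((c * (G x : ℝ))⁻¹) + 1 := by
      rw [hL_G]; exact Int.ceil_lt_add_one _
    rw [Real.logb_inv, neg_neg, Real.logb_mul hc0.ne' hg.ne'] at h1
    have h2 : (G x : ℝ) ^ ρ = (2 : ℝ) ^ (ρ * Real.logb 2 (G x : ℝ)) := by
      rw [mul_comm, Real.rpow_mul (by norm_num), Real.rpow_logb (by norm_num) (by norm_num) hg]
    rw [h2]
    apply Real.rpow_le_rpow_of_exponent_le (by norm_num)
    nlinarith
  have hB : (∑ x : 𝕏, P x * (Gstar x : ℝ) ^ ρ) ≤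
      ∑ x : 𝕏, P x * (2 : ℝ) ^ (ρ * (Lstar x : ℝ)) :=
    guess_le_length P hP0 ρ hρ Lstar hLstarKraft Gstar hGstar hGstarOrd
  have hB0 : 0 < ∑ x : 𝕏, P x * (Gstar x : ℝ) ^ ρ := by
    have : ∑ x : 𝕏, P x ≤ ∑ x : 𝕏, P x * (Gstar x : ℝ) ^ ρ := by
      apply Finset.sum_le_sum
      intro x _
      have : (1 : ℝ) ≤ (Gstar x : ℝ) ^ ρ :=
        Real.one_le_rpow (by exact_mod_cast hS1 x) hρ.le
      nlinarith [hP0 x]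
    linarith
  have hA0 : 0 ≤ ∑ x : 𝕏, P x * (G x : ℝ) ^ ρ :=
    Finset.sum_nonneg fun x _ => mul_nonneg (hP0 x) (by positivity)
  rw [ge_iff_le, div_mul_eq_mul_div]
  exact div_le_div₀ hA0 hA hB0 hB
end

section
/- Let P be a PMF on a finite set 𝕏, ρ > 0, c = ∑_{i=1}^{|𝕏|} 1/i. Let G* be a guessing function ordering 𝕏 in decreasing order of P-probabilities (minimizing E[G(X)^ρ] over guessing functions) and let L* be a length function minimizing E[2^{ρL(X)}] over length functions. Then |(1/ρ)·log₂ E[G*(X)^ρ] − (1/ρ)·log₂ E[2^{ρ L*(X)}]| ≤ 1 + log₂ c. -/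
theorem aux_guess {𝕏 : Type*} [Fintype 𝕏]
    (P : 𝕏 → ℝ) (hP0 : ∀ x, 0 ≤ P x) (ρ : ℝ) (hρ : 0 < ρ)
    (G : 𝕏 → ℕ) (hG : Set.BijOn G Set.univ (Set.Icc 1 (Fintype.card 𝕏)))
    (hGord : ∀ x x', G x ≤ G x' → P x' ≤ P x)
    (L : 𝕏 → ℕ) (hL : ∑ x : 𝕏, (2 : ℝ) ^ (-(L x : ℤ)) ≤ 1) :
    ∑ x : 𝕏, P x * (G x : ℝ) ^ ρ ≤ ∑ x : 𝕏, P x * (2 : ℝ) ^ (ρ * (L x : ℝ)) := by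
  have hmem : ∀ x, 1 ≤ G x ∧ G x ≤ Fintype.card 𝕏 := fun x => hG.mapsTo (Set.mem_univ x)
  have hinj : Function.Injective G := fun x y h => hG.injOn (Set.mem_univ x) (Set.mem_univ y) h
  let f : 𝕏 → Fin (Fintype.card 𝕏) := fun x => ⟨G x - 1, by have := hmem x; omega⟩
  have hf : Function.Bijective f := by
    rw [Fintype.bijective_iff_injective_and_card]
    refine ⟨fun x y h => hinj ?_, by simp⟩
    have h1 : G x - 1 = G y - 1 := congrArg Fin.val h
    have := hmem x; have := hmem y; omega
  let e : 𝕏 ≃ Fin (Fintype.card 𝕏) := Equiv.ofBijective f hf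
  have he : ∀ x, G x = (e x : ℕ) + 1 := fun x => by
    have h1 : (e x : ℕ) = G x - 1 := rfl
    have := hmem x; omega
  let τ := Tuple.sort (L ∘ e.symm)
  have hmono : Monotone ((L ∘ e.symm) ∘ τ) := Tuple.monotone_sort _
  let σ : Equiv.Perm 𝕏 := (e.trans τ.symm).trans e.symm
  have key : ∀ x, (G (σ x) : ℝ) ≤ (2 : ℝ) ^ (L x : ℝ) := by
    intro x
    set i := τ.symm (e x) with hi
    have hGi : G (σ x) = (i : ℕ) + 1 := by rw [he]; simp [σ, hi]
    have hLi : L (e.symm (τ i)) = L x := by simp [hi]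
    have h1 : ∑ x : 𝕏, (2 : ℝ) ^ (-(L x : ℤ))
        = ∑ j, (2 : ℝ) ^ (-(L (e.symm (τ j)) : ℤ)) :=
      ((τ.trans e.symm).sum_comp (fun x => (2 : ℝ) ^ (-(L x : ℤ)))).symm
    have h2 : ∑ j ∈ Finset.Iic i, (2 : ℝ) ^ (-(L x : ℤ))
        ≤ ∑ j, (2 : ℝ) ^ (-(L (e.symm (τ j)) : ℤ)) := by
      refine le_trans (Finset.sum_le_sum (fun j hj => ?_))
        (Finset.sum_le_sum_of_subset_of_nonneg (Finset.subset_univ _)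
          (fun _ _ _ => by positivity))
      have h3 : L (e.symm (τ j)) ≤ L (e.symm (τ i)) := hmono (Finset.mem_Iic.1 hj)
      rw [hLi] at h3
      apply zpow_le_zpow_right₀ (by norm_num)
      omega
    rw [Finset.sum_const, Fin.card_Iic, ← hGi, nsmul_eq_mul, zpow_neg, zpow_natCast,
      ← div_eq_mul_inv] at h2
    rw [h1] at hL
    have h4 := h2.trans hL
    rw [div_le_one (by positivity)] at h4
    rwa [Real.rpow_natCast]
  have hanti : Antivary P (fun x => (G x : ℝ) ^ ρ) := by
    intro x y hxy
    apply hGord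
    by_contra hlt
    push Not at hlt
    have : (G y : ℝ) ^ ρ ≤ (G x : ℝ) ^ ρ :=
      Real.rpow_le_rpow (by positivity) (by exact_mod_cast hlt.le) hρ.le
    exact absurd hxy (not_lt.2 this)
  refine (hanti.sum_mul_le_sum_mul_comp_perm (σ := σ)).trans (Finset.sum_le_sum fun x _ => ?_)
  refine mul_le_mul_of_nonneg_left ?_ (hP0 x)
  rw [mul_comm ρ, Real.rpow_mul (by norm_num)]
  exact Real.rpow_le_rpow (by positivity) (key x) hρ.le


/-!
STATEMENT 5: Let `P` be a PMF on a finite set `𝕏`, `ρ > 0`, `c = ∑_{i=1}^{|𝕏|} 1/i`.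
Let `G*` guess in decreasing order of `P`-probabilities (hence minimizing
`E[G(X)^ρ]` over guessing functions) and let `L*` minimize `E[2^{ρ L(X)}]` over
length functions. Then
`|(1/ρ)·log₂ E[G*(X)^ρ] − (1/ρ)·log₂ E[2^{ρ L*(X)}]| ≤ 1 + log₂ c`.
-/
theorem stmt_5 {𝕏 : Type*} [Fintype 𝕏] [Nonempty 𝕏]
    (P : 𝕏 → ℝ) (hP0 : ∀ x, 0 ≤ P x) (hP1 : ∑ x : 𝕏, P x = 1)
    (ρ : ℝ) (hρ : 0 < ρ)
    (c : ℝ) (hc : c = ∑ i ∈ Finset.Icc 1 (Fintype.card 𝕏), (1 : ℝ) / i)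
    -- an optimal guessing function `G*` (decreasing order of `P`-probabilities)
    (Gstar : 𝕏 → ℕ) (hGstar : Set.BijOn Gstar Set.univ (Set.Icc 1 (Fintype.card 𝕏)))
    (hGstarOrd : ∀ x x', Gstar x ≤ Gstar x' → P x' ≤ P x)
    -- an optimal length function `L*`
    (Lstar : 𝕏 → ℕ) (hLstarKraft : ∑ x : 𝕏, (2 : ℝ) ^ (-(Lstar x : ℤ)) ≤ 1)
    (hLstarMin : ∀ L' : 𝕏 → ℕ, (∑ x : 𝕏, (2 : ℝ) ^ (-(L' x : ℤ)) ≤ 1) →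
      ∑ x : 𝕏, P x * (2 : ℝ) ^ (ρ * (Lstar x : ℝ)) ≤
        ∑ x : 𝕏, P x * (2 : ℝ) ^ (ρ * (L' x : ℝ))) :
    |(1 / ρ) * Real.logb 2 (∑ x : 𝕏, P x * (Gstar x : ℝ) ^ ρ) -
        (1 / ρ) * Real.logb 2 (∑ x : 𝕏, P x * (2 : ℝ) ^ (ρ * (Lstar x : ℝ)))| ≤
      1 + Real.logb 2 c := by
  have hmem : ∀ x, 1 ≤ Gstar x ∧ Gstar x ≤ Fintype.card 𝕏 :=
    fun x => hGstar.mapsTo (Set.mem_univ x)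
  have hmemR : ∀ x, (1 : ℝ) ≤ Gstar x := fun x => by exact_mod_cast (hmem x).1
  have hsum : ∑ x : 𝕏, (1 : ℝ) / Gstar x = c := by
    rw [hc]
    refine Finset.sum_bij (fun x _ => Gstar x) (fun x _ => Finset.mem_Icc.2 (hmem x))
      (fun x _ y _ h => hGstar.injOn (Set.mem_univ x) (Set.mem_univ y) h) ?_ (fun _ _ => rfl)
    intro b hb
    obtain ⟨x, -, hx⟩ := hGstar.surjOn (Finset.mem_Icc.1 hb)
    exact ⟨x, Finset.mem_univ _, hx⟩
  have hc1 : 1 ≤ c := by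
    rw [hc]
    have h := Finset.single_le_sum (f := fun i : ℕ => (1 : ℝ) / i)
      (s := Finset.Icc 1 (Fintype.card 𝕏)) (fun i _ => by positivity)
      (Finset.mem_Icc.2 ⟨le_refl 1, Fintype.card_pos⟩)
    simpa using h
  have hc0 : 0 < c := by linarith
  have hlogc : 0 ≤ Real.logb 2 c := Real.logb_nonneg (by norm_num) hc1
  have hA : 1 ≤ ∑ x : 𝕏, P x * (Gstar x : ℝ) ^ ρ := by
    rw [← hP1]
    exact Finset.sum_le_sum fun x _ =>
      le_mul_of_one_le_right (hP0 x) (Real.one_le_rpow (hmemR x) hρ.le)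
  have hAB := aux_guess P hP0 ρ hρ Gstar hGstar hGstarOrd Lstar hLstarKraft
  have hBA : ∑ x : 𝕏, P x * (2 : ℝ) ^ (ρ * (Lstar x : ℝ)) ≤
      (2 * c) ^ ρ * ∑ x : 𝕏, P x * (Gstar x : ℝ) ^ ρ := by
    let L' : 𝕏 → ℕ := fun x => ⌈Real.logb 2 (c * Gstar x)⌉₊
    have hcg : ∀ x, 1 ≤ c * Gstar x := fun x => one_le_mul_of_one_le_of_one_le hc1 (hmemR x)
    have hlow : ∀ x, c * Gstar x ≤ (2 : ℝ) ^ (L' x : ℝ) := fun x => by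
      rw [← Real.logb_le_iff_le_rpow (by norm_num) (by linarith [hcg x])]
      exact Nat.le_ceil _
    have hup : ∀ x, (2 : ℝ) ^ (L' x : ℝ) ≤ 2 * c * Gstar x := fun x => by
      rw [← Real.le_logb_iff_rpow_le (by norm_num) (by have := hmemR x; positivity), mul_assoc,
        Real.logb_mul (by norm_num) (by linarith [hcg x]), Real.logb_self_eq_one (by norm_num)]
      have := Nat.ceil_lt_add_one (Real.logb_nonneg (b := 2) (by norm_num) (hcg x))
      linarith
    have hK : ∑ x : 𝕏, (2 : ℝ) ^ (-(L' x : ℤ)) ≤ 1 := by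
      have h1 : ∑ x : 𝕏, (1 : ℝ) / Gstar x * (1 / c) = 1 := by
        rw [← Finset.sum_mul, hsum]; field_simp
      rw [← h1]
      refine Finset.sum_le_sum fun x _ => ?_
      have h2 := hlow x
      rw [Real.rpow_natCast] at h2
      rw [zpow_neg, zpow_natCast, div_mul_div_comm, one_mul, ← one_div, mul_comm (Gstar x : ℝ)]
      exact one_div_le_one_div_of_le (by linarith [hcg x]) h2
    refine (hLstarMin L' hK).trans ?_
    rw [Finset.mul_sum]
    refine Finset.sum_le_sum fun x _ => ?_
    rw [mul_left_comm]
    refine mul_le_mul_of_nonneg_left ?_ (hP0 x)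
    rw [mul_comm ρ, Real.rpow_mul (by norm_num), ← Real.mul_rpow (by positivity) (by positivity)]
    exact Real.rpow_le_rpow (by positivity) (hup x) hρ.le
  generalize (∑ x : 𝕏, P x * (Gstar x : ℝ) ^ ρ) = A at *
  generalize (∑ x : 𝕏, P x * (2 : ℝ) ^ (ρ * (Lstar x : ℝ))) = B at *
  have h1 : Real.logb 2 A ≤ Real.logb 2 B :=
    Real.logb_le_logb_of_le (by norm_num) (by linarith) hAB
  have h2 : Real.logb 2 B ≤ ρ * (1 + Real.logb 2 c) + Real.logb 2 A := by
    have h3 := Real.logb_le_logb_of_le (b := 2) (by norm_num) (by linarith) hBA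
    rwa [Real.logb_mul (by positivity) (by linarith), Real.logb_rpow_eq_mul_logb_of_pos
      (by positivity), Real.logb_mul (by norm_num) hc0.ne',
      Real.logb_self_eq_one (by norm_num)] at h3
  rw [← mul_sub, abs_le]
  have h4 : (1 / ρ) * (Real.logb 2 A - Real.logb 2 B) ≤ 0 :=
    mul_nonpos_of_nonneg_of_nonpos (by positivity) (by linarith)
  refine ⟨?_, by linarith⟩
  rw [one_div, ← div_eq_inv_mul, le_div_iff₀ hρ]
  linarith
end

section
/- Let 𝕄 be a finite message set, 𝕂 a finite key set, 𝕐 a set, and f : 𝕄 × 𝕂 → 𝕐 an encryption function such that x ↦ f(x,u) is injective for each u ∈ 𝕂. Let L be any length function on 𝕄. Then there exists an attack strategy G (a family of injective maps G(·|y) : 𝕄 → {1,2,…} for each y ∈ 𝕐) such that for every x ∈ 𝕄 and every key u ∈ 𝕂, G(x | f(x,u)) ≤ 2·min{|𝕂|, 2^{L(x)}}. -/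
/-!
STATEMENT 6: Shannon cipher system with finite message set `𝕄`, finite key set
`𝕂`, cryptogram set `𝕐`, and encryption function `f : 𝕄 × 𝕂 → 𝕐` such that
`x ↦ f (x, u)` is injective for each key `u`. For any length function `L` on `𝕄`
(satisfying Kraft's inequality) there is an attack strategy `G` (a family of
injective maps `G (·|y) : 𝕄 → {1, 2, …}`) such that for every message `x` and
key `u`, `G (x | f (x, u)) ≤ 2 · min {|𝕂|, 2^{L x}}`.
-/
theorem stmt_6 {𝕄 𝕂 𝕐 : Type*} [Fintype 𝕄] [Nonempty 𝕄] [Fintype 𝕂] [Nonempty 𝕂]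
    (f : 𝕄 × 𝕂 → 𝕐) (hf : ∀ u : 𝕂, Function.Injective fun x => f (x, u))
    (L : 𝕄 → ℕ) (hKraft : ∑ x : 𝕄, (2 : ℝ) ^ (-(L x : ℤ)) ≤ 1) :
    ∃ G : 𝕐 → 𝕄 → ℕ,
      (∀ y, Function.Injective (G y)) ∧ (∀ y x, 1 ≤ G y x) ∧
      ∀ (x : 𝕄) (u : 𝕂), G (f (x, u)) x ≤ 2 * min (Fintype.card 𝕂) (2 ^ L x) := by
  classical
  have key : ∀ y : 𝕐, ∃ g : 𝕄 → ℕ, Function.Injective g ∧ (∀ x, 1 ≤ g x) ∧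
      ∀ (x : 𝕄) (u : 𝕂), f (x, u) = y → g x ≤ 2 * min (Fintype.card 𝕂) (2 ^ L x) := by
    intro y
    let k : 𝕄 → ℕ ×ₗ (ℕ ×ₗ Fin (Fintype.card 𝕄)) := fun x =>
      toLex (if ∃ u, f (x, u) = y then 0 else 1, toLex (L x, Fintype.equivFin 𝕄 x))
    have hk : Function.Injective k := by
      intro a b h
      have h1 := congrArg (fun z => (ofLex (ofLex z).2).2) h
      exact (Fintype.equivFin 𝕄).injective h1
    refine ⟨fun x => (Finset.univ.filter fun x' => k x' ≤ k x).card, ?_, ?_, ?_⟩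
    · have mono : ∀ a b, k a < k b → (Finset.univ.filter fun x' => k x' ≤ k a).card <
          (Finset.univ.filter fun x' => k x' ≤ k b).card := by
        intro a b h
        apply Finset.card_lt_card
        rw [Finset.ssubset_iff_of_subset]
        · exact ⟨b, by simp, by simpa using h⟩
        · intro x hx
          simp only [Finset.mem_filter, Finset.mem_univ, true_and] at hx ⊢
          exact hx.trans h.le
      intro a b h
      by_contra hne
      rcases lt_or_gt_of_ne (fun h' => hne (hk h')) with h' | h'
      · exact (mono _ _ h').ne h
      · exact (mono _ _ h').ne' h
    · intro x
      exact Finset.card_pos.mpr ⟨x, by simp⟩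
    · intro x u hu
      have hx : ∃ u, f (x, u) = y := ⟨u, hu⟩
      have sub : ∀ x', k x' ≤ k x → (∃ u, f (x', u) = y) ∧ L x' ≤ L x := by
        intro x' h
        simp only [k, Prod.Lex.toLex_le_toLex, hx, if_true] at h
        by_cases hx' : ∃ u, f (x', u) = y
        · refine ⟨hx', ?_⟩
          simp only [hx', if_true] at h
          omega
        · simp [hx'] at h
      have h1 : (Finset.univ.filter fun x' => k x' ≤ k x).card ≤ Fintype.card 𝕂 := by
        have hc : ∀ x', ∃ u, k x' ≤ k x → f (x', u) = y := by
          intro x'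
          by_cases h : k x' ≤ k x
          · obtain ⟨u, hu⟩ := (sub x' h).1
            exact ⟨u, fun _ => hu⟩
          · exact ⟨u, fun h' => absurd h' h⟩
        choose c hc using hc
        apply Finset.card_le_card_of_injOn c (fun _ _ => Finset.mem_univ _)
        intro a ha b hb hab
        simp only [Finset.coe_filter, Finset.mem_univ, true_and, Set.mem_setOf_eq] at ha hb
        apply hf (c a)
        change f (a, c a) = f (b, c a)
        rw [hc a ha, hab, hc b hb]
      have h2 : (Finset.univ.filter fun x' => k x' ≤ k x).card ≤ 2 ^ L x := by
        have e1 : ((Finset.univ.filter fun x' => k x' ≤ k x).card : ℝ) * (2 : ℝ) ^ (-(L x : ℤ))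
            ≤ 1 := by
          refine le_trans ?_ hKraft
          rw [← nsmul_eq_mul]
          refine (Finset.card_nsmul_le_sum _ (fun x' => (2 : ℝ) ^ (-(L x' : ℤ))) _ ?_).trans
            (Finset.sum_le_sum_of_subset_of_nonneg (Finset.subset_univ _)
              (fun _ _ _ => by positivity))
          intro x' hx'
          have := (sub x' (by simpa using hx')).2
          exact zpow_le_zpow_right₀ (by norm_num) (by omega)
        rw [zpow_neg, zpow_natCast, ← div_eq_mul_inv, div_le_one (by positivity)] at e1
        exact_mod_cast e1
      have := le_min h1 h2
      change (Finset.univ.filter fun x' => k x' ≤ k x).card ≤ _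
      omega
  choose G h1 h2 h3 using key
  exact ⟨G, h1, h2, fun x u => h3 _ x u rfl⟩
end

section
/- Let P be a PMF on a finite message set 𝕄, let ρ > 0, let 𝕂 be a finite key set of size M = |𝕂|, and let c = ∑_{i=1}^{|𝕄|} 1/i. Then there exist an encryption function f : 𝕄 × 𝕂 → 𝕐 (with x ↦ f(x,u) injective for each u) and a length function L on 𝕄 such that every attack strategy G satisfies E[G(X|Y)^ρ] ≥ (2c)^{−ρ}·(2+ρ)^{−1}·E[(min{2^{L(X)}, M})^ρ], where X ~ P, U is uniform on 𝕂 independent of X, and Y = f(X,U). -/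
open Finset in
lemma aux_bern (ρ : ℝ) (hρ : 0 < ρ) (M : ℕ) :
    (M : ℝ) * (M : ℝ) ^ ρ ≤ (1 + ρ) * ∑ j ∈ range M, ((j : ℝ) + 1) ^ ρ := by
  induction M with
  | zero => simp
  | succ m ih =>
    rw [sum_range_succ, mul_add]
    have hm : (0 : ℝ) < (m : ℝ) + 1 := by positivity
    have hb := one_add_mul_self_le_rpow_one_add (s := -(1 / ((m : ℝ) + 1))) (p := 1 + ρ)
      (by rw [neg_le_neg_iff, div_le_one hm]; linarith [(Nat.cast_nonneg m : (0 : ℝ) ≤ m)]) (by linarith)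
    have h1 : 1 + -(1 / ((m : ℝ) + 1)) = m / (m + 1) := by field_simp; ring
    rw [h1, Real.div_rpow (by positivity) (by positivity), le_div_iff₀ (by positivity),
      Real.rpow_add hm, Real.rpow_one] at hb
    have h2 : (m : ℝ) ^ (1 + ρ) = m * (m : ℝ) ^ ρ := by
      rw [Real.rpow_add' (by positivity) (by linarith), Real.rpow_one]
    rw [h2] at hb
    have h3 : (1 + (1 + ρ) * -(1 / ((m : ℝ) + 1))) * (((m : ℝ) + 1) * ((m : ℝ) + 1) ^ ρ)
        = ((m : ℝ) + 1) * ((m : ℝ) + 1) ^ ρ - (1 + ρ) * ((m : ℝ) + 1) ^ ρ := by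
      field_simp
      ring
    push_cast
    linarith

open Finset in
lemma aux_prefix (g : ℕ → ℝ) (hg : Monotone g) (k : ℕ) :
    ∀ S : Finset ℕ, S.card = k → (∀ x ∈ S, 1 ≤ x) →
      ∑ i ∈ range k, g (i + 1) ≤ ∑ x ∈ S, g x := by
  induction k with
  | zero => intro S hS _; simp [card_eq_zero.mp hS]
  | succ k ih =>
    intro S hS h1
    have hne : S.Nonempty := card_pos.mp (by omega)
    have hmem := S.max'_mem hne
    have hk : k + 1 ≤ S.max' hne := by
      have hsub : S ⊆ Icc 1 (S.max' hne) := fun x hx => mem_Icc.mpr ⟨h1 x hx, S.le_max' x hx⟩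
      have := card_le_card hsub
      simp at this
      omega
    rw [sum_range_succ, ← sum_erase_add S g hmem]
    exact add_le_add (ih _ (by rw [card_erase_of_mem hmem]; omega)
      (fun x hx => h1 x (mem_of_mem_erase hx))) (hg hk)

open Finset in
lemma aux_abel (p d : ℕ → ℝ) (hp : Antitone p) (hp0 : ∀ n, 0 ≤ p n)
    (hd : ∀ k, 0 ≤ ∑ j ∈ range k, d j) (m : ℕ) :
    0 ≤ ∑ j ∈ range m, p j * d j := by
  have key : ∀ m, p m * ∑ j ∈ range m, d j ≤ ∑ j ∈ range m, p j * d j := by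
    intro m
    induction m with
    | zero => simp
    | succ m ih =>
      rw [sum_range_succ (fun j => p j * d j)]
      have h1 := mul_le_mul_of_nonneg_right (hp (Nat.le_succ m)) (hd (m + 1))
      have h2 : p m * ∑ j ∈ range (m + 1), d j = p m * ∑ j ∈ range m, d j + p m * d m := by
        rw [sum_range_succ, mul_add]
      simp only [Nat.succ_eq_add_one] at h1
      linarith
  exact (mul_nonneg (hp0 m) (hd m)).trans (key m)

open Finset in
lemma aux_block (ρ : ℝ) (hρ : 0 < ρ) (p : ℕ → ℝ) (hp : Antitone p) (hp0 : ∀ n, 0 ≤ p n)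
    (N m : ℕ) (hN : ∀ j, N ≤ j → p j = 0) (H : ℕ → ℕ) (hH1 : ∀ j, 1 ≤ H j)
    (hH : ∀ i j, i < N → j < N → i < m → j < m → H i = H j → i = j) :
    ∑ j ∈ range m, p j * ((j : ℝ) + 1) ^ ρ ≤ ∑ j ∈ range m, p j * (H j : ℝ) ^ ρ := by
  have h := aux_abel p (fun j => if j < N ∧ j < m then (H j : ℝ) ^ ρ - ((j : ℝ) + 1) ^ ρ else 0)
    hp hp0 ?_ m
  · rw [← sub_nonneg, ← sum_sub_distrib]
    refine h.trans_eq (sum_congr rfl fun j hj => ?_)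
    have := mem_range.mp hj
    by_cases hjN : j < N
    · simp [hjN, this, mul_sub]
    · simp [hN j (not_lt.mp hjN)]
  · intro k
    induction k with
    | zero => simp
    | succ k ih =>
      by_cases hk : k < N ∧ k < m
      · have h3 := aux_prefix (fun n => (n : ℝ) ^ ρ)
          (fun a b hab => Real.rpow_le_rpow (by positivity) (by exact_mod_cast hab) hρ.le)
          (k + 1) ((range (k + 1)).image H) (by
            rw [card_image_of_injOn, card_range]
            intro a ha b hb hab
            simp at ha hb
            exact hH a b (by omega) (by omega) (by omega) (by omega) hab)
          (by intro x hx; obtain ⟨a, -, rfl⟩ := mem_image.mp hx; exact hH1 a)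
        rw [sum_image (by
            intro a ha b hb hab
            simp at ha hb
            exact hH a b (by omega) (by omega) (by omega) (by omega) hab)] at h3
        rw [← sub_nonneg, ← sum_sub_distrib] at h3
        refine h3.trans_eq (sum_congr rfl fun j hj => ?_)
        have := mem_range.mp hj
        rw [if_pos (by omega)]
        push_cast
        rfl
      · rw [sum_range_succ, if_neg hk, add_zero]; exact ih

open Finset in
lemma aux_split (F : ℕ → ℝ) (M K : ℕ) :
    ∑ n ∈ range (K * M), F n = ∑ b ∈ range K, ∑ j ∈ range M, F (b * M + j) := by
  induction K with
  | zero => simp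
  | succ K ih => rw [sum_range_succ, ← ih, Nat.succ_mul, sum_range_add]

open Finset in
lemma aux_main (ρ : ℝ) (hρ : 0 < ρ) (p : ℕ → ℝ) (hp : Antitone p) (hp0 : ∀ n, 0 ≤ p n)
    (M : ℕ) (K : ℕ) :
    ∑ n ∈ range (K * M), p n * (min ((n : ℝ) + 1) M) ^ ρ
      ≤ (2 + ρ) * ∑ b ∈ range K, ∑ j ∈ range M, p (b * M + j) * ((j : ℝ) + 1) ^ ρ := by
  rw [aux_split]
  have hE : ∀ b, 0 ≤ ∑ j ∈ range M, p (b * M + j) * ((j : ℝ) + 1) ^ ρ := fun b =>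
    sum_nonneg fun j _ => mul_nonneg (hp0 _) (by positivity)
  cases K with
  | zero => simp
  | succ K =>
    rw [sum_range_succ']
    have h0 : ∑ j ∈ range M, p (0 * M + j) * (min (((0 * M + j : ℕ) : ℝ) + 1) M) ^ ρ
        ≤ ∑ j ∈ range M, p (0 * M + j) * ((j : ℝ) + 1) ^ ρ := by
      refine sum_le_sum fun j _ => mul_le_mul_of_nonneg_left ?_ (hp0 _)
      refine Real.rpow_le_rpow (by positivity) ?_ hρ.le
      simp
    have h1 : ∀ b, ∑ j ∈ range M, p ((b + 1) * M + j) * (min ((((b + 1) * M + j : ℕ) : ℝ) + 1) M) ^ ρ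
        ≤ (1 + ρ) * ∑ j ∈ range M, p (b * M + j) * ((j : ℝ) + 1) ^ ρ := by
      intro b
      calc _ ≤ ∑ j ∈ range M, p ((b + 1) * M) * (M : ℝ) ^ ρ := by
            refine sum_le_sum fun j _ => mul_le_mul (hp (by omega)) ?_ (by positivity) (hp0 _)
            exact Real.rpow_le_rpow (by positivity) (min_le_right _ _) hρ.le
        _ = p ((b + 1) * M) * ((M : ℝ) * (M : ℝ) ^ ρ) := by simp; ring
        _ ≤ p ((b + 1) * M) * ((1 + ρ) * ∑ j ∈ range M, ((j : ℝ) + 1) ^ ρ) :=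
            mul_le_mul_of_nonneg_left (aux_bern ρ hρ M) (hp0 _)
        _ = (1 + ρ) * ∑ j ∈ range M, p ((b + 1) * M) * ((j : ℝ) + 1) ^ ρ := by
            rw [← mul_sum]; ring
        _ ≤ _ := by
            refine mul_le_mul_of_nonneg_left (sum_le_sum fun j hj => ?_) (by positivity)
            have := mem_range.mp hj
            exact mul_le_mul_of_nonneg_right (hp (by rw [Nat.succ_mul]; omega)) (by positivity)
    have h2 := sum_le_sum (s := range K) fun b _ => h1 b
    rw [← mul_sum] at h2
    have h3 := sum_range_succ' (fun b => ∑ j ∈ range M, p (b * M + j) * ((j : ℝ) + 1) ^ ρ) K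
    have h4 := sum_range_succ (fun b => ∑ j ∈ range M, p (b * M + j) * ((j : ℝ) + 1) ^ ρ) K
    have h5 := hE K
    have h6 := hE 0
    have h7 : 0 ≤ ∑ b ∈ range K, ∑ j ∈ range M, p ((b + 1) * M + j) * ((j : ℝ) + 1) ^ ρ :=
      sum_nonneg fun b _ => hE (b + 1)
    have h8 := mul_nonneg (by linarith : (0 : ℝ) ≤ 1 + ρ) h5
    have e1 : (2 + ρ) * ∑ b ∈ range (K + 1), ∑ j ∈ range M, p (b * M + j) * ((j : ℝ) + 1) ^ ρ
       = ∑ b ∈ range (K + 1), (∑ j ∈ range M, p (b * M + j) * ((j : ℝ) + 1) ^ ρ) +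
        (1 + ρ) * ∑ b ∈ range (K + 1), ∑ j ∈ range M, p (b * M + j) * ((j : ℝ) + 1) ^ ρ := by ring
    rw [e1]
    nth_rewrite 1 [h3]
    rw [h4]
    linarith

lemma aux_sort {𝕄 : Type} [Fintype 𝕄] (P : 𝕄 → ℝ) :
    ∃ e : Fin (Fintype.card 𝕄) ≃ 𝕄, Antitone (P ∘ e) := by
  let e0 := (Fintype.equivFin 𝕄).symm
  refine ⟨(Tuple.sort (fun i => -P (e0 i))).trans e0, ?_⟩
  intro i j hij
  have := Tuple.monotone_sort (fun i => -P (e0 i)) hij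
  simpa using this

/-- messages indexed by rank -/
lemma aux_guess_s7 {𝕄 : Type} [Fintype 𝕄] [Nonempty 𝕄] (P : 𝕄 → ℝ) (hP0 : ∀ x, 0 ≤ P x)
    (ρ : ℝ) (hρ : 0 < ρ) (M : ℕ) (hM : 0 < M)
    {N : ℕ} (e : Fin N ≃ 𝕄) (he : Antitone (P ∘ e)) (H : 𝕄 → ℕ) (h1 : ∀ x, 1 ≤ H x)
    (hH : ∀ x y, (e.symm x : ℕ) / M = (e.symm y : ℕ) / M → H x = H y → x = y) :
    ∑ x, P x * (min (((e.symm x : ℕ) : ℝ) + 1) M) ^ ρ ≤ (2 + ρ) * ∑ x, P x * (H x : ℝ) ^ ρ := by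
  classical
  let p : ℕ → ℝ := fun n => if h : n < N then P (e ⟨n, h⟩) else 0
  let H' : ℕ → ℕ := fun n => if h : n < N then H (e ⟨n, h⟩) else 1
  have hp0 : ∀ n, 0 ≤ p n := by
    intro n; simp only [p]; split_ifs; exacts [hP0 _, le_rfl]
  have hpN : ∀ n, N ≤ n → p n = 0 := fun n hn => by simp [p, not_lt.mpr hn]
  have hp : Antitone p := by
    intro a b hab
    by_cases hb : b < N
    · have ha : a < N := lt_of_le_of_lt hab hb
      simp only [p, ha, hb, dif_pos]
      exact he (show (⟨a, ha⟩ : Fin N) ≤ ⟨b, hb⟩ from hab)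
    · rw [hpN b (not_lt.mp hb)]; exact hp0 a
  have hNM : N ≤ N * M := Nat.le_mul_of_pos_right _ hM
  have conv : ∀ (F : ℕ → ℝ), ∑ n ∈ Finset.range (N * M), p n * F n
      = ∑ x, P x * F (e.symm x : ℕ) := by
    intro F
    rw [← Finset.sum_subset (Finset.range_subset_range.mpr hNM)
      (fun n _ hn => by rw [hpN n (by simpa using hn), zero_mul]), ← e.sum_comp,
      Finset.sum_range]
    refine Finset.sum_congr rfl fun i _ => ?_
    simp [p]
  have hm := aux_main ρ hρ p hp hp0 M N
  rw [conv (fun n => (min ((n : ℝ) + 1) M) ^ ρ)] at hm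
  refine hm.trans (mul_le_mul_of_nonneg_left ?_ (by linarith))
  have hc2 := conv (fun n => (H' n : ℝ) ^ ρ)
  have : ∑ x, P x * (H x : ℝ) ^ ρ = ∑ x, P x * (H' (e.symm x : ℕ) : ℝ) ^ ρ := by
    refine Finset.sum_congr rfl fun x _ => ?_
    simp [H']
  rw [this, ← hc2, aux_split]
  refine Finset.sum_le_sum fun b _ => ?_
  refine aux_block ρ hρ (fun j => p (b * M + j)) (fun a c hac => hp (by omega)) (fun _ => hp0 _)
    (N - b * M) M (fun j hj => hpN _ (by omega)) (fun j => H' (b * M + j)) ?_ ?_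
  · intro j
    simp only [H']
    split_ifs
    exacts [h1 _, le_rfl]
  · intro i j hi hj hi' hj' hij
    have hi2 : b * M + i < N := by omega
    have hj2 : b * M + j < N := by omega
    simp only [H', hi2, hj2, dif_pos] at hij
    have := hH _ _ (by
      simp only [Equiv.symm_apply_apply]
      rw [mul_comm, Nat.mul_add_div hM, Nat.mul_add_div hM, Nat.div_eq_of_lt hi',
        Nat.div_eq_of_lt hj']) hij
    have := congrArg Fin.val (e.injective this)
    simp at this
    exact this


/-!
STATEMENT 7: Shannon cipher system: `X ~ P` on a finite message set `𝕄`, key `U`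
uniform on a finite set `𝕂` of size `M = |𝕂|`, independent of `X`, cryptogram
`Y = f (X, U)`. With `c = ∑_{i=1}^{|𝕄|} 1/i` and `ρ > 0`, there exist an
encryption function `f : 𝕄 × 𝕂 → 𝕐` (with `x ↦ f (x,u)` injective for each `u`)
and a length function `L` on `𝕄` such that every attack strategy `G` (a family
of injective maps `G (·|y) : 𝕄 → {1, 2, …}`) satisfies
`E[G(X|Y)^ρ] ≥ (2c)^{-ρ} (2+ρ)^{-1} E[(min {2^{L(X)}, M})^ρ]`.
-/
theorem stmt_7 {𝕄 𝕂 : Type} [Fintype 𝕄] [Nonempty 𝕄] [Fintype 𝕂] [Nonempty 𝕂]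
    (P : 𝕄 → ℝ) (hP0 : ∀ x, 0 ≤ P x) (hP1 : ∑ x : 𝕄, P x = 1)
    (ρ : ℝ) (hρ : 0 < ρ)
    (c : ℝ) (hc : c = ∑ i ∈ Finset.Icc 1 (Fintype.card 𝕄), (1 : ℝ) / i) :
    ∃ (𝕐 : Type) (f : 𝕄 × 𝕂 → 𝕐) (L : 𝕄 → ℕ),
      (∀ u : 𝕂, Function.Injective fun x => f (x, u)) ∧
      (∑ x : 𝕄, (2 : ℝ) ^ (-(L x : ℤ)) ≤ 1) ∧
      ∀ G : 𝕐 → 𝕄 → ℕ, (∀ y, Function.Injective (G y)) → (∀ y x, 1 ≤ G y x) →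
        ∑ x : 𝕄, ∑ u : 𝕂, P x * (Fintype.card 𝕂 : ℝ)⁻¹ * (G (f (x, u)) x : ℝ) ^ ρ ≥
          (2 * c) ^ (-ρ) * (2 + ρ)⁻¹ *
            ∑ x : 𝕄, P x * (min ((2 : ℝ) ^ (L x)) (Fintype.card 𝕂 : ℝ)) ^ ρ := by
  classical
  obtain ⟨e, he⟩ := aux_sort P
  have hM : 0 < Fintype.card 𝕂 := Fintype.card_pos
  have hNpos : 0 < Fintype.card 𝕄 := Fintype.card_pos
  set M := Fintype.card 𝕂 with hMdef
  haveI : NeZero M := ⟨hM.ne'⟩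
  let k : 𝕂 ≃ ZMod M := Fintype.equivOfCardEq (by rw [ZMod.card])
  have hc1 : 1 ≤ c := by
    rw [hc]
    have := Finset.single_le_sum (f := fun i : ℕ => (1 : ℝ) / i) (s := Finset.Icc 1 (Fintype.card 𝕄))
      (fun i _ => by positivity) (Finset.mem_Icc.mpr ⟨le_rfl, hNpos⟩)
    simpa using this
  have hR : ∀ x, (1 : ℝ) ≤ ((e.symm x : ℕ) : ℝ) + 1 := fun x => by
    linarith [(Nat.cast_nonneg (e.symm x : ℕ) : (0 : ℝ) ≤ ((e.symm x : ℕ) : ℝ))]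
  have hL : ∀ x, ∃ l : ℕ, c * (((e.symm x : ℕ) : ℝ) + 1) ≤ 2 ^ l ∧
      (2 : ℝ) ^ l ≤ 2 * c * (((e.symm x : ℕ) : ℝ) + 1) := by
    intro x
    obtain ⟨n, h1, h2⟩ := exists_nat_pow_near (x := c * (((e.symm x : ℕ) : ℝ) + 1)) (y := 2)
      (one_le_mul_of_one_le_of_one_le hc1 (hR x)) (by norm_num)
    exact ⟨n + 1, h2.le, by rw [pow_succ]; linarith⟩
  choose L hL1 hL2 using hL
  refine ⟨ℕ × ZMod M, fun xu => ((e.symm xu.1 : ℕ) / M, ((e.symm xu.1 : ℕ) : ZMod M) + k xu.2), L,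
    ?_, ?_, ?_⟩
  · intro u x y hxy
    simp only [Prod.mk.injEq, add_left_inj] at hxy
    obtain ⟨h1, h2⟩ := hxy
    rw [ZMod.natCast_eq_natCast_iff'] at h2
    apply e.symm.injective
    apply Fin.ext
    rw [← Nat.div_add_mod (e.symm x : ℕ) M, ← Nat.div_add_mod (e.symm y : ℕ) M, h1, h2]
  · calc _ ≤ ∑ x : 𝕄, c⁻¹ * (1 / (((e.symm x : ℕ) : ℝ) + 1)) := by
          refine Finset.sum_le_sum fun x _ => ?_
          rw [zpow_neg, zpow_natCast, one_div, ← mul_inv]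
          have := hR x
          exact inv_anti₀ (by positivity) (hL1 x)
      _ = c⁻¹ * c := by
          rw [← Finset.mul_sum, ← e.sum_comp]
          congr 1
          simp only [Equiv.symm_apply_apply]
          rw [hc, ← Finset.sum_range (fun n => (1 : ℝ) / ((n : ℝ) + 1)), Finset.range_eq_Ico,
            ← Finset.Ico_add_one_right_eq_Icc]
          rw [Finset.sum_Ico_eq_sum_range, Finset.sum_Ico_eq_sum_range]
          refine Finset.sum_congr rfl fun i _ => ?_
          push_cast
          rw [zero_add, add_comm]
      _ = 1 := inv_mul_cancel₀ (by positivity)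
      _ ≤ 1 := le_rfl
  · intro G hG hG1
    have hMr : (0 : ℝ) < M := by exact_mod_cast hM
    have e1 : ∑ x : 𝕄, ∑ u : 𝕂, P x * (M : ℝ)⁻¹ *
        (G ((e.symm x : ℕ) / M, ((e.symm x : ℕ) : ZMod M) + k u) x : ℝ) ^ ρ
        = (M : ℝ)⁻¹ * ∑ s : ZMod M, ∑ x : 𝕄, P x * (G ((e.symm x : ℕ) / M, s) x : ℝ) ^ ρ := by
      rw [Finset.sum_comm (s := (Finset.univ : Finset (ZMod M))), Finset.mul_sum]
      refine Finset.sum_congr rfl fun x _ => ?_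
      rw [← ((k.trans (Equiv.addLeft ((e.symm x : ℕ) : ZMod M))).sum_comp), Finset.mul_sum]
      refine Finset.sum_congr rfl fun u _ => ?_
      simp only [Equiv.trans_apply, Equiv.coe_addLeft]
      ring
    have e2 : ∀ s : ZMod M, (2 + ρ)⁻¹ * ∑ x, P x * (min (((e.symm x : ℕ) : ℝ) + 1) M) ^ ρ ≤
        ∑ x : 𝕄, P x * (G ((e.symm x : ℕ) / M, s) x : ℝ) ^ ρ := by
      intro s
      rw [inv_mul_le_iff₀ (by linarith)]
      refine aux_guess_s7 P hP0 ρ hρ M hM e he (fun x => G ((e.symm x : ℕ) / M, s) x)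
        (fun x => hG1 _ _) ?_
      intro x y hxy h
      simp only [hxy] at h
      exact hG _ h
    have e3 := Finset.sum_le_sum (s := Finset.univ) fun s _ => e2 s
    rw [Finset.sum_const, Finset.card_univ, ZMod.card, nsmul_eq_mul] at e3
    have e4 : (2 + ρ)⁻¹ * ∑ x, P x * (min (((e.symm x : ℕ) : ℝ) + 1) M) ^ ρ ≤
        (M : ℝ)⁻¹ * ∑ s : ZMod M, ∑ x : 𝕄, P x * (G ((e.symm x : ℕ) / M, s) x : ℝ) ^ ρ := by
      rw [le_inv_mul_iff₀ hMr]; exact e3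
    have e5 : (2 * c) ^ (-ρ) * ∑ x : 𝕄, P x * (min ((2 : ℝ) ^ (L x)) (M : ℝ)) ^ ρ ≤
        ∑ x, P x * (min (((e.symm x : ℕ) : ℝ) + 1) M) ^ ρ := by
      rw [Real.rpow_neg (by positivity), inv_mul_le_iff₀ (by positivity), Finset.mul_sum]
      refine Finset.sum_le_sum fun x _ => ?_
      rw [mul_left_comm, ← Real.mul_rpow (by positivity) (by positivity)]
      refine mul_le_mul_of_nonneg_left ?_ (hP0 x)
      refine Real.rpow_le_rpow (by positivity) ?_ hρ.le
      rw [mul_min_of_nonneg _ _ (by positivity)]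
      refine min_le_min (hL2 x) ?_
      nlinarith
    refine ge_iff_le.mpr (le_trans ?_ (e4.trans_eq e1.symm))
    rw [mul_comm ((2 * c) ^ (-ρ)), mul_assoc]
    exact mul_le_mul_of_nonneg_left e5 (by positivity)
end

section
/- Let a unifilar source be given by finite alphabet 𝕏, finite state space 𝕊, initial state s₀, next-state map φ (with x ↦ φ(x,s) injective for each s), and transition probabilities P(x|s). For every x^n ∈ 𝕏^n: (i) the size of the type satisfies |T_{x^n}| ≤ 2^{n·H(Q_{x^n})}, and (ii) the probability of the type satisfies P_n{T_{x^n}} ≤ 2^{−n·D(Q_{x^n}‖P)}, where Q_{x^n} is the empirical joint PMF of x^n, H the empirical conditional entropy, and D the conditional divergence. -/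
/-!
STATEMENT 11: For a unifilar source (finite alphabet `𝕏`, finite state space `𝕊`,
initial state `s₀`, next-state map `φ` with `x ↦ φ x s` injective for each `s`,
transition probabilities `P (x|s)`), and every `x^n ∈ 𝕏^n`, writing
`T_{x^n} = {a^n : Q_{a^n} = Q_{x^n}}` for the type of `x^n`:
(i) `|T_{x^n}| ≤ 2^{n H(Q_{x^n})}` and (ii) `P_n(T_{x^n}) ≤ 2^{-n D(Q_{x^n}‖P)}`.
-/

noncomputable section

open scoped Classical

/-- The state sequence of a unifilar source: `s_0 = s₀`, `s_{i+1} = φ x_{i+1} s_i`. -/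
def stateSeq {𝕏 𝕊 : Type*} (φ : 𝕏 → 𝕊 → 𝕊) (s₀ : 𝕊) {n : ℕ} (x : Fin n → 𝕏) : ℕ → 𝕊
  | 0 => s₀
  | i + 1 => if h : i < n then φ (x ⟨i, h⟩) (stateSeq φ s₀ x i) else stateSeq φ s₀ x i

/-- `P_n(x^n) = ∏_{i=1}^n P(x_i | s_{i-1})` for a unifilar source. -/
def srcProb {𝕏 𝕊 : Type*} (P : 𝕏 → 𝕊 → ℝ) (φ : 𝕏 → 𝕊 → 𝕊) (s₀ : 𝕊) {n : ℕ}
    (x : Fin n → 𝕏) : ℝ :=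
  ∏ i : Fin n, P (x i) (stateSeq φ s₀ x i.1)

/-- The empirical joint PMF on (letter, previous state) pairs:
`Q_{x^n}(a, s) = (1/n) ∑_{i=1}^n 1{x_i = a, s_{i-1} = s}`. -/
def empPMF {𝕏 𝕊 : Type*} (φ : 𝕏 → 𝕊 → 𝕊) (s₀ : 𝕊)
    {n : ℕ} (x : Fin n → 𝕏) (a : 𝕏) (s : 𝕊) : ℝ :=
  (1 / (n : ℝ)) * ∑ i : Fin n,
    if x i = a ∧ stateSeq φ s₀ x i.1 = s then (1 : ℝ) else 0

/-- Conditional (empirical) entropy `H(Q) = -∑_{s,a} Q(a,s) log₂ q(a|s)` where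
`q(a|s) = Q(a,s)/Q(s)` (conventions `0 log 0 = 0`, `x/0 = 0`, `log 0 = 0`). -/
def condEnt {𝕏 𝕊 : Type*} [Fintype 𝕏] [Fintype 𝕊] (Q : 𝕏 → 𝕊 → ℝ) : ℝ :=
  -∑ s : 𝕊, ∑ a : 𝕏, Q a s * Real.logb 2 (Q a s / ∑ b : 𝕏, Q b s)

/-- Conditional divergence `D(Q‖P) = ∑_{s,a} Q(a,s) log₂ (q(a|s)/P(a|s))`. -/
def condDiv {𝕏 𝕊 : Type*} [Fintype 𝕏] [Fintype 𝕊] (Q P : 𝕏 → 𝕊 → ℝ) : ℝ :=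
  ∑ s : 𝕊, ∑ a : 𝕏, Q a s * Real.logb 2 ((Q a s / ∑ b : 𝕏, Q b s) / P a s)

lemma stateSeq_cons {𝕏 𝕊 : Type*} (φ : 𝕏 → 𝕊 → 𝕊) (s₀ : 𝕊) {n : ℕ} (c : 𝕏) (y : Fin n → 𝕏)
    (i : ℕ) : stateSeq φ s₀ (Fin.cons c y : Fin (n + 1) → 𝕏) (i + 1)
      = stateSeq φ (φ c s₀) y i := by
  induction i with
  | zero =>
    have h0 : (⟨0, Nat.succ_pos n⟩ : Fin (n + 1)) = 0 := rfl
    simp [stateSeq]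
  | succ i ih =>
    rw [stateSeq, ih]
    conv_rhs => rw [stateSeq]
    by_cases h : i < n
    · have h1 : i + 1 < n + 1 := by omega
      have h2 : (⟨i + 1, h1⟩ : Fin (n + 1)) = Fin.succ ⟨i, h⟩ := rfl
      simp only [h, h1, dif_pos, h2, Fin.cons_succ]
    · have h1 : ¬ (i + 1 < n + 1) := by omega
      simp only [h, h1, dif_neg, not_false_eq_true]

lemma srcProb_cons {𝕏 𝕊 : Type*} (W : 𝕏 → 𝕊 → ℝ) (φ : 𝕏 → 𝕊 → 𝕊) (s₀ : 𝕊) {n : ℕ}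
    (c : 𝕏) (y : Fin n → 𝕏) :
    srcProb W φ s₀ (Fin.cons c y : Fin (n + 1) → 𝕏) = W c s₀ * srcProb W φ (φ c s₀) y := by
  unfold srcProb
  rw [Fin.prod_univ_succ]
  congr 1
  refine Finset.prod_congr rfl fun i _ => ?_
  rw [Fin.cons_succ, Fin.val_succ, stateSeq_cons]

lemma sum_srcProb_le {𝕏 𝕊 : Type*} [Fintype 𝕏] (W : 𝕏 → 𝕊 → ℝ) (φ : 𝕏 → 𝕊 → 𝕊)
    (h0 : ∀ a s, 0 ≤ W a s) (h1 : ∀ s, ∑ a, W a s ≤ 1) (n : ℕ) :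
    ∀ s₀, ∑ a : Fin n → 𝕏, srcProb W φ s₀ a ≤ 1 := by
  induction n with
  | zero => intro s₀; simp [srcProb]
  | succ n ih =>
    intro s₀
    rw [← (Fin.consEquiv fun _ => 𝕏).sum_comp, Fintype.sum_prod_type]
    calc _ = ∑ c, W c s₀ * ∑ y : Fin n → 𝕏, srcProb W φ (φ c s₀) y := by
          refine Finset.sum_congr rfl fun c _ => ?_
          rw [Finset.mul_sum]
          exact Finset.sum_congr rfl fun y _ => srcProb_cons W φ s₀ c y
      _ ≤ ∑ c, W c s₀ := Finset.sum_le_sum fun c _ =>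
          mul_le_of_le_one_right (h0 _ _) (ih _)
      _ ≤ 1 := h1 s₀

lemma empPMF_nonneg {𝕏 𝕊 : Type*} (φ : 𝕏 → 𝕊 → 𝕊) (s₀ : 𝕊) {n : ℕ} (x : Fin n → 𝕏)
    (a : 𝕏) (s : 𝕊) : 0 ≤ empPMF φ s₀ x a s := by
  unfold empPMF
  refine mul_nonneg (by positivity) (Finset.sum_nonneg fun i _ => ?_)
  split_ifs <;> norm_num

lemma empPMF_pos {𝕏 𝕊 : Type*} (φ : 𝕏 → 𝕊 → 𝕊) (s₀ : 𝕊) {n : ℕ} (x : Fin n → 𝕏)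
    (i : Fin n) : 0 < empPMF φ s₀ x (x i) (stateSeq φ s₀ x i.1) := by
  unfold empPMF
  have hn : 0 < n := i.pos
  refine mul_pos (by positivity) (Finset.sum_pos' (fun j _ => ?_) ⟨i, Finset.mem_univ _, ?_⟩)
  · split_ifs <;> norm_num
  · simp

lemma exists_of_empPMF_pos {𝕏 𝕊 : Type*} (φ : 𝕏 → 𝕊 → 𝕊) (s₀ : 𝕊) {n : ℕ} (x : Fin n → 𝕏)
    (a : 𝕏) (s : 𝕊) (h : 0 < empPMF φ s₀ x a s) :
    ∃ i : Fin n, x i = a ∧ stateSeq φ s₀ x i.1 = s := by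
  by_contra hc
  push Not at hc
  have : empPMF φ s₀ x a s = 0 := by
    unfold empPMF
    rw [Finset.sum_eq_zero, mul_zero]
    intro i _
    rw [if_neg]
    rintro ⟨h1, h2⟩
    exact hc i h1 h2
  linarith

lemma sum_emp {𝕏 𝕊 : Type*} [Fintype 𝕏] [Fintype 𝕊] (φ : 𝕏 → 𝕊 → 𝕊) (s₀ : 𝕊) {n : ℕ}
    (hn : 0 < n) (x : Fin n → 𝕏) (f : 𝕏 → 𝕊 → ℝ) :
    ∑ i : Fin n, f (x i) (stateSeq φ s₀ x i.1)
      = n * ∑ s, ∑ a, empPMF φ s₀ x a s * f a s := by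
  have hn' : (n : ℝ) ≠ 0 := by positivity
  have h1 : ∀ s a, empPMF φ s₀ x a s * f a s = (1 / (n : ℝ)) * ∑ i : Fin n,
      (if x i = a ∧ stateSeq φ s₀ x i.1 = s then f a s else 0) := by
    intro s a
    rw [empPMF, mul_assoc, Finset.sum_mul]
    simp only [ite_mul, one_mul, zero_mul]
  simp only [h1, ← Finset.mul_sum]
  rw [← mul_assoc, mul_one_div_cancel hn', one_mul]
  have h2 : ∀ s, ∑ a, ∑ i : Fin n, (if x i = a ∧ stateSeq φ s₀ x i.1 = s then f a s else 0)
      = ∑ i : Fin n, ∑ a, (if x i = a ∧ stateSeq φ s₀ x i.1 = s then f a s else 0) :=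
    fun s => Finset.sum_comm
  simp only [h2]
  rw [Finset.sum_comm]
  refine Finset.sum_congr rfl fun i _ => ?_
  simp [ite_and]

lemma srcProb_eq {𝕏 𝕊 : Type*} [Fintype 𝕏] [Fintype 𝕊] (φ : 𝕏 → 𝕊 → 𝕊) (s₀ : 𝕊) {n : ℕ}
    (hn : 0 < n) (x : Fin n → 𝕏) (V : 𝕏 → 𝕊 → ℝ)
    (hV : ∀ a s, 0 < empPMF φ s₀ x a s → 0 < V a s) :
    srcProb V φ s₀ x
      = (2 : ℝ) ^ ((n : ℝ) * ∑ s, ∑ a, empPMF φ s₀ x a s * Real.logb 2 (V a s)) := by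
  rw [← sum_emp φ s₀ hn x fun a s => Real.logb 2 (V a s),
    Real.rpow_sum_of_pos (by norm_num), srcProb]
  refine Finset.prod_congr rfl fun i _ => ?_
  rw [Real.rpow_logb (by norm_num) (by norm_num) (hV _ _ (empPMF_pos φ s₀ x i))]

theorem stmt_11 {𝕏 𝕊 : Type*} [Fintype 𝕏] [Nonempty 𝕏] [Fintype 𝕊]
    (φ : 𝕏 → 𝕊 → 𝕊) (hφ : ∀ s, Function.Injective fun a => φ a s)
    (s₀ : 𝕊)
    (P : 𝕏 → 𝕊 → ℝ) (hP0 : ∀ a s, 0 ≤ P a s) (hP1 : ∀ s, ∑ a : 𝕏, P a s = 1)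
    (n : ℕ) (hn : 0 < n) (x : Fin n → 𝕏)
    (T : Finset (Fin n → 𝕏))
    (hT : T = Finset.univ.filter fun a => empPMF φ s₀ a = empPMF φ s₀ x) :
    ((T.card : ℝ) ≤ (2 : ℝ) ^ ((n : ℝ) * condEnt (empPMF φ s₀ x)) ∧
      ∑ a ∈ T, srcProb P φ s₀ a ≤
        (2 : ℝ) ^ (-(n : ℝ) * condDiv (empPMF φ s₀ x) P)) := by
  have hmem : ∀ a ∈ T, empPMF φ s₀ a = empPMF φ s₀ x := by
    intro a ha
    rw [hT] at ha
    exact (Finset.mem_filter.mp ha).2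
  clear hT
  set Q := empPMF φ s₀ x with hQ
  have hQ0 : ∀ a s, 0 ≤ Q a s := fun a s => empPMF_nonneg φ s₀ x a s
  have hS0 : ∀ s, 0 ≤ ∑ b, Q b s := fun s => Finset.sum_nonneg fun b _ => hQ0 b s
  let W : 𝕏 → 𝕊 → ℝ := fun a s => Q a s / ∑ b, Q b s
  have hW0 : ∀ a s, 0 ≤ W a s := fun a s => div_nonneg (hQ0 a s) (hS0 s)
  have hW1 : ∀ s, ∑ a, W a s ≤ 1 := by
    intro s
    simp only [W]
    rw [← Finset.sum_div]
    exact div_self_le_one _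
  have hWpos : ∀ a s, 0 < Q a s → 0 < W a s := fun a s h =>
    div_pos h (lt_of_lt_of_le h
      (Finset.single_le_sum (f := fun b => Q b s) (fun b _ => hQ0 b s) (Finset.mem_univ a)))
  have hsum : ∑ a ∈ T, srcProb W φ s₀ a ≤ 1 :=
    (Finset.sum_le_univ_sum_of_nonneg fun a => Finset.prod_nonneg fun i _ => hW0 _ _).trans
      (sum_srcProb_le W φ hW0 hW1 n s₀)
  have hWa : ∀ a ∈ T, srcProb W φ s₀ a = (2 : ℝ) ^ (-((n : ℝ) * condEnt Q)) := by
    intro a ha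
    rw [srcProb_eq φ s₀ hn a W (by rw [hmem a ha]; exact hWpos), hmem a ha]
    congr 1
    simp only [condEnt, W]
    ring
  rw [Finset.sum_congr rfl hWa, Finset.sum_const, nsmul_eq_mul] at hsum
  have h2 : (0 : ℝ) < 2 := by norm_num
  have hcard : (T.card : ℝ) ≤ (2 : ℝ) ^ ((n : ℝ) * condEnt Q) := by
    rw [Real.rpow_neg h2.le] at hsum
    have hp := Real.rpow_pos_of_pos h2 ((n : ℝ) * condEnt Q)
    rwa [← div_eq_mul_inv, div_le_one hp] at hsum
  refine ⟨hcard, ?_⟩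
  by_cases hP : ∀ a s, 0 < Q a s → 0 < P a s
  · have hPa : ∀ a ∈ T, srcProb P φ s₀ a
        = (2 : ℝ) ^ (-(n : ℝ) * condDiv Q P) * (2 : ℝ) ^ (-((n : ℝ) * condEnt Q)) := by
      intro a ha
      rw [srcProb_eq φ s₀ hn a P (by rw [hmem a ha]; exact hP), hmem a ha,
        ← Real.rpow_add h2]
      congr 1
      have hd : condDiv Q P = ∑ s, ∑ a, Q a s * Real.logb 2 (W a s)
          - ∑ s, ∑ a, Q a s * Real.logb 2 (P a s) := by
        rw [condDiv, ← Finset.sum_sub_distrib]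
        refine Finset.sum_congr rfl fun s _ => ?_
        rw [← Finset.sum_sub_distrib]
        refine Finset.sum_congr rfl fun b _ => ?_
        rcases (hQ0 b s).eq_or_lt with h | h
        · simp [← h]
        · rw [Real.logb_div (hWpos b s h).ne' (hP b s h).ne', mul_sub]
      rw [hd]
      simp only [condEnt, W]
      ring
    rw [Finset.sum_congr rfl hPa, Finset.sum_const, nsmul_eq_mul, mul_left_comm]
    exact mul_le_of_le_one_right (Real.rpow_nonneg h2.le _) hsum
  · push Not at hP
    obtain ⟨b, s, hb, hPb⟩ := hP
    have hPb0 : P b s = 0 := le_antisymm hPb (hP0 b s)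
    rw [Finset.sum_eq_zero]
    · exact Real.rpow_nonneg h2.le _
    · intro a ha
      rw [← hmem a ha] at hb
      obtain ⟨i, hi1, hi2⟩ := exists_of_empPMF_pos φ s₀ a b s hb
      exact Finset.prod_eq_zero (Finset.mem_univ i) (by rw [hi1, hi2, hPb0])

end
end

section
/- Fix a finite alphabet 𝕏, finite state space 𝕊, and conditional probabilities P(x|s). For every R > 0 and ρ > 0, the exponent E(R,ρ) = max_Q [ρ·min{H(Q),R} − D(Q‖P)] satisfies the minimax identity E(R,ρ) = min_{0 ≤ θ ≤ ρ} [E(θ) + (ρ − θ)·R], where E(θ) = max_Q [θ·H(Q) − D(Q‖P)] and both maxima are over joint PMFs Q on 𝕊 × 𝕏 with D(Q‖P) < ∞. -/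
/-!
STATEMENT 15: With `𝕏`, `𝕊` finite and conditional probabilities `P (x|s)`,
for every `R > 0` and `ρ > 0` the exponent
`E(R,ρ) = max_Q [ρ min{H(Q), R} − D(Q‖P)]` satisfies the minimax identity
`E(R,ρ) = min_{0 ≤ θ ≤ ρ} [E(θ) + (ρ − θ) R]` where
`E(θ) = max_Q [θ H(Q) − D(Q‖P)]`, both maxima being over joint PMFs `Q` on
`𝕊 × 𝕏` with `D(Q‖P) < ∞` (expressed by `Q(a,s) > 0 → P(a|s) > 0`).
-/

noncomputable section

def feas {𝕏 𝕊 : Type*} [Fintype 𝕏] [Fintype 𝕊] (P : 𝕏 → 𝕊 → ℝ) : Set (𝕏 → 𝕊 → ℝ) :=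
  {Q | (∀ a s, 0 ≤ Q a s) ∧ (∑ s : 𝕊, ∑ a : 𝕏, Q a s = 1) ∧ (∀ a s, 0 < Q a s → 0 < P a s)}

lemma feas_convex {𝕏 𝕊 : Type*} [Fintype 𝕏] [Fintype 𝕊] (P : 𝕏 → 𝕊 → ℝ)
    (hP0 : ∀ a s, 0 ≤ P a s) : Convex ℝ (feas P) := by
  rintro Q ⟨h1, h2, h3⟩ Q' ⟨h1', h2', h3'⟩ α β hα hβ hab
  refine ⟨fun a s => ?_, ?_, fun a s h => ?_⟩
  · have := h1 a s
    have := h1' a s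
    simp only [Pi.add_apply, Pi.smul_apply, smul_eq_mul]
    positivity
  · simp only [Pi.add_apply, Pi.smul_apply, smul_eq_mul, Finset.sum_add_distrib,
      ← Finset.mul_sum, h2, h2']
    linarith
  · by_contra hn
    have e1 : Q a s = 0 := le_antisymm (not_lt.1 fun h => hn (h3 a s h)) (h1 a s)
    have e2 : Q' a s = 0 := le_antisymm (not_lt.1 fun h => hn (h3' a s h)) (h1' a s)
    simp [e1, e2] at h

lemma feas_le_one {𝕏 𝕊 : Type*} [Fintype 𝕏] [Fintype 𝕊] {P Q : 𝕏 → 𝕊 → ℝ}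
    (h : Q ∈ feas P) (a : 𝕏) (s : 𝕊) : Q a s ≤ 1 := by
  obtain ⟨h1, h2, h3⟩ := h
  rw [← h2]
  calc Q a s ≤ ∑ a, Q a s := Finset.single_le_sum (f := fun a => Q a s) (fun a _ => h1 a s)
        (Finset.mem_univ a)
    _ ≤ _ := Finset.single_le_sum (f := fun s => ∑ a, Q a s)
        (fun s _ => Finset.sum_nonneg fun a _ => h1 a s) (Finset.mem_univ s)

lemma feas_compact {𝕏 𝕊 : Type*} [Fintype 𝕏] [Fintype 𝕊] (P : 𝕏 → 𝕊 → ℝ)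
    (hP0 : ∀ a s, 0 ≤ P a s) : IsCompact (feas P) := by
  have hc : IsCompact (Set.Icc (0 : 𝕏 → 𝕊 → ℝ) 1) := by
    rw [← Set.pi_univ_Icc]
    refine isCompact_univ_pi fun a => ?_
    rw [← Set.pi_univ_Icc]
    exact isCompact_univ_pi fun s => isCompact_Icc
  refine hc.of_isClosed_subset ?_ fun Q h => ⟨fun a s => h.1 a s, fun a s => feas_le_one h a s⟩
  have : feas P = (⋂ a, ⋂ s, {Q : 𝕏 → 𝕊 → ℝ | 0 ≤ Q a s}) ∩
      {Q | ∑ s : 𝕊, ∑ a : 𝕏, Q a s = 1} ∩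
      (⋂ a, ⋂ s, ⋂ (_ : ¬ 0 < P a s), {Q : 𝕏 → 𝕊 → ℝ | Q a s ≤ 0}) := by
    ext Q
    simp only [feas, Set.mem_setOf_eq, Set.mem_inter_iff, Set.mem_iInter, and_assoc]
    refine and_congr_right fun _ => and_congr_right fun _ => ?_
    exact forall_congr' fun a => forall_congr' fun s =>
      ⟨fun h hn => not_lt.1 (mt h hn), fun h hQ => by_contra fun hn => absurd (h hn) (not_le.2 hQ)⟩
  rw [this]
  refine (IsClosed.inter ?_ ?_).inter ?_
  · exact isClosed_iInter fun a => isClosed_iInter fun s =>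
      isClosed_le continuous_const (by fun_prop)
  · exact isClosed_eq (by fun_prop) continuous_const
  · exact isClosed_iInter fun a => isClosed_iInter fun s => isClosed_iInter fun _ =>
      isClosed_le (by fun_prop) continuous_const

lemma feas_nonempty {𝕏 𝕊 : Type*} [Fintype 𝕏] [Fintype 𝕊] [Nonempty 𝕊] (P : 𝕏 → 𝕊 → ℝ)
    (hP0 : ∀ a s, 0 ≤ P a s) (hP1 : ∀ s, ∑ a : 𝕏, P a s = 1) : (feas P).Nonempty := by
  have hc : (0 : ℝ) < Fintype.card 𝕊 := by exact_mod_cast Fintype.card_pos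
  refine ⟨fun a s => P a s / Fintype.card 𝕊, fun a s => div_nonneg (hP0 a s) hc.le, ?_,
    fun a s h => ?_⟩
  · simp only [← Finset.sum_div, hP1]
    simp
  · by_contra hn
    have : P a s = 0 := le_antisymm (not_lt.1 hn) (hP0 a s)
    simp [this] at h

lemma term_ineq {x u y v : ℝ} (hx : 0 ≤ x) (hu : x ≤ u) (hy : 0 ≤ y)
    (hv : 0 ≤ v) (hxy : 0 < x → 0 < y ∧ 0 < v) :
    x * Real.log (y / v) + x - u * (y / v) ≤ x * Real.log (x / u) := by
  rcases hx.eq_or_lt with rfl | hx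
  · have : 0 ≤ u * (y / v) := by positivity
    simp; exact this
  obtain ⟨hy, hv⟩ := hxy hx
  have hu : 0 < u := hx.trans_le hu
  have h1 := Real.one_sub_inv_le_log_of_pos (x := (x / u) / (y / v)) (by positivity)
  rw [Real.log_div (by positivity) (by positivity)] at h1
  have h2 := mul_le_mul_of_nonneg_left h1 hx.le
  have h3 : x * (1 - (x / u / (y / v))⁻¹) = x - u * (y / v) := by
    field_simp
  rw [h3] at h2
  linarith

lemma phi_convex {x u x' u' α β : ℝ} (hx : 0 ≤ x) (hu : x ≤ u) (hx' : 0 ≤ x') (hu' : x' ≤ u')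
    (hα : 0 ≤ α) (hβ : 0 ≤ β) (hab : α + β = 1) :
    (α * x + β * x') * Real.log ((α * x + β * x') / (α * u + β * u')) ≤
      α * (x * Real.log (x / u)) + β * (x' * Real.log (x' / u')) := by
  rcases hα.eq_or_lt with rfl | hα
  · have : β = 1 := by linarith
    subst this; simp
  rcases hβ.eq_or_lt with rfl | hβ
  · have : α = 1 := by linarith
    subst this; simp
  have hu0 := hx.trans hu
  have hu0' := hx'.trans hu'
  set y := α * x + β * x' with hy
  set v := α * u + β * u' with hv
  have h1 := term_ineq (x := x) (u := u) (y := y) (v := v) hx hu (by positivity) (by positivity)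
    (fun h => by have := h.trans_le hu; constructor <;> positivity)
  have h2 := term_ineq (x := x') (u := u') (y := y) (v := v) hx' hu' (by positivity)
    (by positivity) (fun h => by have := h.trans_le hu'; constructor <;> positivity)
  have h3 : v * (y / v) = y := by
    rcases (show 0 ≤ v by positivity).eq_or_lt with h | h
    · have : y ≤ v := by
        have := mul_le_mul_of_nonneg_left hu hα.le
        have := mul_le_mul_of_nonneg_left hu' hβ.le
        linarith
      have hy0 : 0 ≤ y := by positivity
      have : y = 0 := by linarith
      simp [this]
    · field_simp
  have h4 := mul_le_mul_of_nonneg_left h1 hα.le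
  have h5 := mul_le_mul_of_nonneg_left h2 hβ.le
  have h6 : y * Real.log (y / v) = α * (x * Real.log (y / v) + x - u * (y / v)) +
      β * (x' * Real.log (y / v) + x' - u' * (y / v)) := by
    have : y * Real.log (y / v) = y * Real.log (y / v) + y - v * (y / v) := by rw [h3]; ring
    rw [this]
    generalize Real.log (y / v) = L
    generalize y / v = r
    rw [hy, hv]; ring
  linarith

lemma condEnt_concave {𝕏 𝕊 : Type*} [Fintype 𝕏] [Fintype 𝕊] (P : 𝕏 → 𝕊 → ℝ)
    (hP0 : ∀ a s, 0 ≤ P a s) : ConcaveOn ℝ (feas P) condEnt := by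
  refine ⟨feas_convex P hP0, ?_⟩
  rintro Q ⟨h1, -, -⟩ Q' ⟨h1', -, -⟩ α β hα hβ hab
  have hl : 0 < Real.log 2 := Real.log_pos (by norm_num)
  simp only [condEnt, smul_eq_mul, mul_neg, ← neg_add, Finset.mul_sum, ← Finset.sum_add_distrib,
    Pi.add_apply, Pi.smul_apply]
  refine neg_le_neg (Finset.sum_le_sum fun s _ => Finset.sum_le_sum fun a _ => ?_)
  have := phi_convex (h1 a s) (Finset.single_le_sum (f := fun a => Q a s) (fun a _ => h1 a s)
    (Finset.mem_univ a)) (h1' a s) (Finset.single_le_sum (f := fun a => Q' a s)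
    (fun a _ => h1' a s) (Finset.mem_univ a)) hα hβ hab
  have := div_le_div_of_nonneg_right this hl.le
  simp only [Finset.sum_add_distrib, ← Finset.mul_sum, Real.logb]
  refine le_trans (le_of_eq ?_) (this.trans (le_of_eq ?_)) <;> ring

lemma condEnt_cont {𝕏 𝕊 : Type*} [Fintype 𝕏] [Fintype 𝕊] (P : 𝕏 → 𝕊 → ℝ) :
    ContinuousOn condEnt (feas P) := by
  have : Continuous fun Q : 𝕏 → 𝕊 → ℝ => -∑ s : 𝕊, ((∑ a : 𝕏, Q a s * Real.log (Q a s)) -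
      (∑ a : 𝕏, Q a s) * Real.log (∑ a : 𝕏, Q a s)) / Real.log 2 := by
    refine Continuous.neg (continuous_finsetSum _ fun s _ => Continuous.div_const
      (Continuous.sub (continuous_finsetSum _ fun a _ => ?_) ?_) _)
    · exact Real.continuous_mul_log.comp (f := fun Q : 𝕏 → 𝕊 → ℝ => Q a s) (by fun_prop)
    · exact Real.continuous_mul_log.comp (f := fun Q : 𝕏 → 𝕊 → ℝ => ∑ a, Q a s) (by fun_prop)
  refine this.continuousOn.congr ?_
  rintro Q ⟨h1, -, -⟩
  simp only [condEnt]
  congr 1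
  refine Finset.sum_congr rfl fun s _ => ?_
  rw [Finset.sum_mul, ← Finset.sum_sub_distrib, Finset.sum_div]
  refine Finset.sum_congr rfl fun a _ => ?_
  rcases (h1 a s).eq_or_lt with h | h
  · simp [← h]
  · have : 0 < ∑ b, Q b s := h.trans_le (Finset.single_le_sum (f := fun a => Q a s)
      (fun a _ => h1 a s) (Finset.mem_univ a))
    rw [Real.logb, Real.log_div h.ne' this.ne']
    ring

lemma condDiv_eq {𝕏 𝕊 : Type*} [Fintype 𝕏] [Fintype 𝕊] {P Q : 𝕏 → 𝕊 → ℝ} (hQ : Q ∈ feas P) :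
    condDiv Q P = -condEnt Q - ∑ s : 𝕊, ∑ a : 𝕏, Q a s * Real.logb 2 (P a s) := by
  obtain ⟨h1, -, h3⟩ := hQ
  simp only [condDiv, condEnt, neg_neg, ← Finset.sum_sub_distrib]
  refine Finset.sum_congr rfl fun s _ => Finset.sum_congr rfl fun a _ => ?_
  rcases (h1 a s).eq_or_lt with h | h
  · simp [← h]
  · have : 0 < ∑ b, Q b s := h.trans_le (Finset.single_le_sum (f := fun a => Q a s)
      (fun a _ => h1 a s) (Finset.mem_univ a))
    rw [Real.logb_div (div_pos h this).ne' (h3 a s h).ne']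
    ring

lemma obj_concave {𝕏 𝕊 : Type*} [Fintype 𝕏] [Fintype 𝕊] (P : 𝕏 → 𝕊 → ℝ)
    (hP0 : ∀ a s, 0 ≤ P a s) {θ : ℝ} (hθ : 0 ≤ θ) (c : ℝ) :
    ConcaveOn ℝ (feas P) (fun Q => θ * condEnt Q - condDiv Q P + c) := by
  have hc := condEnt_concave P hP0
  refine ⟨hc.1, ?_⟩
  intro Q hQ Q' hQ' α β hα hβ hab
  have h := hc.2 hQ hQ' hα hβ hab
  simp only [smul_eq_mul] at h ⊢
  rw [condDiv_eq hQ, condDiv_eq hQ', condDiv_eq (hc.1 hQ hQ' hα hβ hab)]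
  have e : ∑ s : 𝕊, ∑ a : 𝕏, (α • Q + β • Q') a s * Real.logb 2 (P a s) =
      α * (∑ s : 𝕊, ∑ a : 𝕏, Q a s * Real.logb 2 (P a s)) +
      β * (∑ s : 𝕊, ∑ a : 𝕏, Q' a s * Real.logb 2 (P a s)) := by
    simp only [Pi.add_apply, Pi.smul_apply, smul_eq_mul, Finset.mul_sum,
      ← Finset.sum_add_distrib]
    refine Finset.sum_congr rfl fun s _ => Finset.sum_congr rfl fun a _ => ?_
    ring
  rw [e]
  have h' := mul_le_mul_of_nonneg_left h (show 0 ≤ 1 + θ by linarith)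
  have hcc : c = α * c + β * c := by rw [← add_mul, hab, one_mul]
  linarith

lemma obj_cont {𝕏 𝕊 : Type*} [Fintype 𝕏] [Fintype 𝕊] (P : 𝕏 → 𝕊 → ℝ) (θ c : ℝ) :
    ContinuousOn (fun Q => θ * condEnt Q - condDiv Q P + c) (feas P) := by
  have hc := condEnt_cont P
  have : ContinuousOn (fun Q : 𝕏 → 𝕊 → ℝ => θ * condEnt Q - (-condEnt Q -
      ∑ s : 𝕊, ∑ a : 𝕏, Q a s * Real.logb 2 (P a s)) + c) (feas P) := by fun_prop
  exact this.congr fun Q hQ => by simp only [condDiv_eq hQ]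

theorem stmt_15 {𝕏 𝕊 : Type*} [Fintype 𝕏] [Nonempty 𝕏] [Fintype 𝕊] [Nonempty 𝕊]
    (P : 𝕏 → 𝕊 → ℝ) (hP0 : ∀ a s, 0 ≤ P a s) (hP1 : ∀ s, ∑ a : 𝕏, P a s = 1)
    (R ρ : ℝ) (hR : 0 < R) (hρ : 0 < ρ)
    (ERρ : ℝ)
    (hERρ : ERρ = sSup {v : ℝ | ∃ Q : 𝕏 → 𝕊 → ℝ,
      (∀ a s, 0 ≤ Q a s) ∧ (∑ s : 𝕊, ∑ a : 𝕏, Q a s = 1) ∧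
      (∀ a s, 0 < Q a s → 0 < P a s) ∧
      v = ρ * min (condEnt Q) R - condDiv Q P})
    (E : ℝ → ℝ)
    (hE : ∀ θ : ℝ, E θ = sSup {v : ℝ | ∃ Q : 𝕏 → 𝕊 → ℝ,
      (∀ a s, 0 ≤ Q a s) ∧ (∑ s : 𝕊, ∑ a : 𝕏, Q a s = 1) ∧
      (∀ a s, 0 < Q a s → 0 < P a s) ∧
      v = θ * condEnt Q - condDiv Q P}) :
    ERρ = ⨅ θ : Set.Icc (0 : ℝ) ρ, (E θ.1 + (ρ - θ.1) * R) := by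
  have hKc := feas_compact P hP0
  have hKn := feas_nonempty P hP0 hP1
  have hset : ∀ g : (𝕏 → 𝕊 → ℝ) → ℝ, {v : ℝ | ∃ Q : 𝕏 → 𝕊 → ℝ,
      (∀ a s, 0 ≤ Q a s) ∧ (∑ s : 𝕊, ∑ a : 𝕏, Q a s = 1) ∧
      (∀ a s, 0 < Q a s → 0 < P a s) ∧ v = g Q} = g '' feas P := by
    intro g
    ext v
    constructor
    · rintro ⟨Q, h1, h2, h3, h⟩
      exact ⟨Q, ⟨h1, h2, h3⟩, h.symm⟩
    · rintro ⟨Q, ⟨h1, h2, h3⟩, h⟩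
      exact ⟨Q, h1, h2, h3, h.symm⟩
  rw [hset fun Q => ρ * min (condEnt Q) R - condDiv Q P] at hERρ
  have hE' : ∀ θ, E θ = sSup ((fun Q => θ * condEnt Q - condDiv Q P) '' feas P) := fun θ => by
    rw [hE, hset fun Q => θ * condEnt Q - condDiv Q P]
  have hEb : ∀ θ, ∀ Q ∈ feas P, θ * condEnt Q - condDiv Q P ≤ E θ := by
    intro θ Q hQ
    rw [hE']
    refine le_csSup ?_ ⟨Q, hQ, rfl⟩
    have := obj_cont P θ 0
    simp only [add_zero] at this
    exact hKc.bddAbove_image this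
  obtain ⟨θ₀, hθ₀, Q₀, hQ₀, hs⟩ := Sion.exists_isSaddlePointOn (X := Set.Icc (0 : ℝ) ρ)
    (Y := feas P) (f := fun θ Q => θ * condEnt Q - condDiv Q P + (ρ - θ) * R)
    ⟨0, le_rfl, hρ.le⟩ (convex_Icc 0 ρ) isCompact_Icc
    (fun Q _ => Continuous.lowerSemicontinuous (by fun_prop) |>.lowerSemicontinuousOn _)
    (fun Q _ => ConvexOn.quasiconvexOn ⟨convex_Icc 0 ρ, fun x _ y _ α β _ _ hab => by
      obtain rfl : β = 1 - α := by linarith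
      simp only [smul_eq_mul]
      apply le_of_eq
      ring⟩)
    (feas_convex P hP0) hKn hKc
    (fun θ _ => (obj_cont P θ _).upperSemicontinuousOn)
    (fun θ hθ => (obj_concave P hP0 hθ.1 _).quasiconcaveOn)
  -- the pointwise lower bound
  have hmin : ∀ Q, ∀ θ ∈ Set.Icc (0 : ℝ) ρ, ρ * min (condEnt Q) R - condDiv Q P ≤
      θ * condEnt Q - condDiv Q P + (ρ - θ) * R := by
    intro Q θ hθ
    have h1 := mul_le_mul_of_nonneg_left (min_le_left (condEnt Q) R) hθ.1
    have h2 := mul_le_mul_of_nonneg_left (min_le_right (condEnt Q) R) (sub_nonneg.2 hθ.2)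
    linarith
  have hle : ∀ θ ∈ Set.Icc (0 : ℝ) ρ, ∀ Q ∈ feas P, ρ * min (condEnt Q) R - condDiv Q P ≤
      E θ + (ρ - θ) * R := fun θ hθ Q hQ =>
    (hmin Q θ hθ).trans (by have := hEb θ Q hQ; linarith)
  haveI : Nonempty (Set.Icc (0 : ℝ) ρ) := ⟨⟨0, le_rfl, hρ.le⟩⟩
  apply le_antisymm
  · rw [hERρ]
    refine csSup_le (hKn.image _) ?_
    rintro _ ⟨Q, hQ, rfl⟩
    exact le_ciInf fun θ => hle θ.1 θ.2 Q hQ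
  · refine (ciInf_le ⟨ρ * min (condEnt Q₀) R - condDiv Q₀ P, ?_⟩ ⟨θ₀, hθ₀⟩).trans ?_
    · rintro _ ⟨θ, rfl⟩
      exact hle θ.1 θ.2 Q₀ hQ₀
    have hbdd : BddAbove ((fun Q => ρ * min (condEnt Q) R - condDiv Q P) '' feas P) := by
      refine ⟨E 0 + (ρ - 0) * R, ?_⟩
      rintro _ ⟨Q, hQ, rfl⟩
      exact hle 0 ⟨le_rfl, hρ.le⟩ Q hQ
    have h1 : ρ * min (condEnt Q₀) R - condDiv Q₀ P ≤ ERρ := by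
      rw [hERρ]
      exact le_csSup hbdd ⟨Q₀, hQ₀, rfl⟩
    have h2 : E θ₀ ≤ ρ * min (condEnt Q₀) R - condDiv Q₀ P - (ρ - θ₀) * R := by
      rw [hE']
      refine csSup_le (hKn.image _) ?_
      rintro _ ⟨Q, hQ, rfl⟩
      rcases le_total (condEnt Q₀) R with h | h
      · have := hs ρ ⟨hρ.le, le_rfl⟩ Q hQ
        rw [min_eq_left h]
        simp only at this ⊢
        linarith
      · have := hs 0 ⟨le_rfl, hρ.le⟩ Q hQ
        rw [min_eq_right h]
        simp only at this ⊢
        linarith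
    simp only
    linarith


end
end

section
/- Fix a finite alphabet 𝕏, finite state space 𝕊, conditional probabilities P(x|s), and ρ > 0. Let E(R,ρ) = max_Q [ρ·min{H(Q),R} − D(Q‖P)] and E(θ) = max_Q [θ·H(Q) − D(Q‖P)] (maxima over joint PMFs Q on 𝕊 × 𝕏 with D(Q‖P) < ∞). Then: (i) if there exists a joint PMF Q* whose conditional satisfies q*(x|s) = P(x|s) for all x,s with Q*(s) > 0 and H(Q*) ≥ R, then E(R,ρ) = ρ·R; (ii) for every R > 0 there exists θ₀ ∈ [0,ρ] such that E(R,ρ) = (ρ − θ₀)·R + E(θ₀); (iii) if E(·) is differentiable at ρ and R > E'(ρ), then E(R,ρ) = E(ρ). -/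
/-!
STATEMENT 16: With `𝕏`, `𝕊` finite, conditional probabilities `P (x|s)`, `ρ > 0`,
`E(R,ρ) = max_Q [ρ min{H(Q), R} − D(Q‖P)]` and `E(θ) = max_Q [θ H(Q) − D(Q‖P)]`
(maxima over joint PMFs `Q` on `𝕊 × 𝕏` with `D(Q‖P) < ∞`):
(i) if there is a joint PMF `Q*` whose conditional satisfies `q*(x|s) = P(x|s)`
whenever `Q*(s) > 0` and with `H(Q*) ≥ R`, then `E(R,ρ) = ρ R`;
(ii) for every `R > 0` there is `θ₀ ∈ [0,ρ]` with `E(R,ρ) = (ρ − θ₀) R + E(θ₀)`;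
(iii) if `E(·)` is differentiable at `ρ` with derivative `E'(ρ)` and `R > E'(ρ)`,
then `E(R,ρ) = E(ρ)`.
-/

noncomputable section

theorem aux_gibbs {𝕏 : Type*} [Fintype 𝕏] (x r : 𝕏 → ℝ) (hx : ∀ a, 0 ≤ x a)
    (hr : ∀ a, 0 ≤ r a) (hr1 : ∑ a, r a ≤ 1) (hxr : ∀ a, 0 < x a → 0 < r a) :
    ∑ a, x a * Real.logb 2 (r a) ≤ ∑ a, x a * Real.logb 2 (x a / ∑ b, x b) := by
  have hS : 0 ≤ ∑ b, x b := Finset.sum_nonneg fun a _ => hx a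
  have hl2 : 0 < Real.log 2 := Real.log_pos (by norm_num)
  have key : ∀ a, x a * Real.log (r a) - x a * Real.log (x a / ∑ b, x b)
      ≤ r a * (∑ b, x b) - x a := by
    intro a
    rcases (hx a).eq_or_lt with h | h
    · rw [← h]; simpa using mul_nonneg (hr a) hS
    · have hSp : 0 < ∑ b, x b :=
        lt_of_lt_of_le h (Finset.single_le_sum (fun a _ => hx a) (Finset.mem_univ a))
      have hra := hxr a h
      have h1 : Real.log (r a) - Real.log (x a / ∑ b, x b)
          = Real.log (r a * (∑ b, x b) / x a) := by
        rw [Real.log_div h.ne' hSp.ne', Real.log_div (by positivity) h.ne',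
          Real.log_mul hra.ne' hSp.ne']
        ring
      have h2 := Real.log_le_sub_one_of_pos (show 0 < r a * (∑ b, x b) / x a by positivity)
      rw [← mul_sub, h1]
      calc _ ≤ x a * (r a * (∑ b, x b) / x a - 1) := by gcongr
        _ = _ := by field_simp
  have hs := Finset.sum_le_sum fun a (_ : a ∈ Finset.univ) => key a
  rw [Finset.sum_sub_distrib, Finset.sum_sub_distrib, ← Finset.sum_mul] at hs
  have h3 : (∑ a, r a) * (∑ b, x b) ≤ 1 * ∑ b, x b := by gcongr
  simp only [Real.logb, ← mul_div_assoc, ← Finset.sum_div]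
  refine div_le_div_of_nonneg_right ?_ hl2.le
  linarith

theorem aux_ent_smul {𝕏 𝕊 : Type*} [Fintype 𝕏] [Fintype 𝕊] (c : ℝ) (Q : 𝕏 → 𝕊 → ℝ) :
    condEnt (c • Q) = c * condEnt Q := by
  by_cases hc : c = 0
  · simp [condEnt, hc]
  · simp only [condEnt, Pi.smul_apply, smul_eq_mul, ← Finset.mul_sum, mul_neg,
      mul_div_mul_left _ _ hc, mul_assoc]

theorem aux_ent_add {𝕏 𝕊 : Type*} [Fintype 𝕏] [Fintype 𝕊] (Q1 Q2 : 𝕏 → 𝕊 → ℝ)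
    (h1 : ∀ a s, 0 ≤ Q1 a s) (h2 : ∀ a s, 0 ≤ Q2 a s) :
    condEnt Q1 + condEnt Q2 ≤ condEnt (Q1 + Q2) := by
  simp only [condEnt, ← neg_add, neg_le_neg_iff, ← Finset.sum_add_distrib]
  refine Finset.sum_le_sum fun s _ => ?_
  have hS : 0 ≤ ∑ b, (Q1 + Q2) b s :=
    Finset.sum_nonneg fun a _ => add_nonneg (h1 a s) (h2 a s)
  have hr : ∀ a, 0 ≤ (Q1 + Q2) a s / ∑ b, (Q1 + Q2) b s :=
    fun a => div_nonneg (add_nonneg (h1 a s) (h2 a s)) hS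
  have hr1 : ∑ a, (Q1 + Q2) a s / ∑ b, (Q1 + Q2) b s ≤ 1 := by
    rw [← Finset.sum_div]; exact div_self_le_one _
  have hpos : ∀ a, 0 < (Q1 + Q2) a s → 0 < (Q1 + Q2) a s / ∑ b, (Q1 + Q2) b s := by
    intro a ha
    exact div_pos ha (lt_of_lt_of_le ha (Finset.single_le_sum
      (f := fun b => (Q1 + Q2) b s)
      (fun a _ => add_nonneg (h1 a s) (h2 a s)) (Finset.mem_univ a)))
  have g1 := aux_gibbs (fun a => Q1 a s) (fun a => (Q1 + Q2) a s / ∑ b, (Q1 + Q2) b s)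
    (fun a => h1 a s) hr hr1 (fun a ha => hpos a (add_pos_of_pos_of_nonneg ha (h2 a s)))
  have g2 := aux_gibbs (fun a => Q2 a s) (fun a => (Q1 + Q2) a s / ∑ b, (Q1 + Q2) b s)
    (fun a => h2 a s) hr hr1 (fun a ha => hpos a (add_pos_of_nonneg_of_pos (h1 a s) ha))
  calc _ = ∑ a, Q1 a s * Real.logb 2 ((Q1 + Q2) a s / ∑ b, (Q1 + Q2) b s)
        + ∑ a, Q2 a s * Real.logb 2 ((Q1 + Q2) a s / ∑ b, (Q1 + Q2) b s) := by
        rw [← Finset.sum_add_distrib]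
        refine Finset.sum_congr rfl fun a _ => ?_
        rw [← add_mul]; rfl
    _ ≤ _ := by rw [Finset.sum_add_distrib]; exact add_le_add g1 g2

theorem aux_ent_cont {𝕏 𝕊 : Type*} [Fintype 𝕏] [Fintype 𝕊] :
    ContinuousOn (condEnt : (𝕏 → 𝕊 → ℝ) → ℝ) {Q | ∀ a s, 0 ≤ Q a s} := by
  have hc : Continuous (fun Q : 𝕏 → 𝕊 → ℝ =>
      ∑ s, ((∑ a, Real.negMulLog (Q a s)) - Real.negMulLog (∑ a, Q a s)) / Real.log 2) := by
    have := Real.continuous_negMulLog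
    refine continuous_finsetSum _ fun s _ => Continuous.div_const (Continuous.sub
      (continuous_finsetSum _ fun a _ => this.comp (by fun_prop)) (this.comp (by fun_prop))) _
  refine hc.continuousOn.congr fun Q hQ => ?_
  simp only [condEnt, ← Finset.sum_neg_distrib]
  refine Finset.sum_congr rfl fun s _ => ?_
  have : Real.negMulLog (∑ a, Q a s) = ∑ a, -(Q a s * Real.log (∑ b, Q b s)) := by
    rw [Real.negMulLog, Finset.sum_neg_distrib, ← Finset.sum_mul]; ring
  rw [this, ← Finset.sum_sub_distrib, Finset.sum_div]
  refine Finset.sum_congr rfl fun a _ => ?_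
  rcases (hQ a s).eq_or_lt with h | h
  · simp [← h]
  · have hSp : 0 < ∑ b, Q b s := lt_of_lt_of_le h (Finset.single_le_sum
      (f := fun b => Q b s) (fun a _ => hQ a s) (Finset.mem_univ a))
    rw [Real.logb, Real.log_div h.ne' hSp.ne', Real.negMulLog]
    ring

def auxK {𝕏 𝕊 : Type*} [Fintype 𝕏] [Fintype 𝕊] (P : 𝕏 → 𝕊 → ℝ) : Set (𝕏 → 𝕊 → ℝ) :=
  {Q | (∀ a s, 0 ≤ Q a s) ∧ (∑ s : 𝕊, ∑ a : 𝕏, Q a s = 1) ∧ (∀ a s, 0 < Q a s → 0 < P a s)}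

def auxL {𝕏 𝕊 : Type*} [Fintype 𝕏] [Fintype 𝕊] (P Q : 𝕏 → 𝕊 → ℝ) : ℝ :=
  ∑ s : 𝕊, ∑ a : 𝕏, Q a s * Real.logb 2 (P a s)

theorem aux_div_eq {𝕏 𝕊 : Type*} [Fintype 𝕏] [Fintype 𝕊] (P Q : 𝕏 → 𝕊 → ℝ)
    (hQ : Q ∈ auxK P) : condDiv Q P = - condEnt Q - auxL P Q := by
  simp only [condDiv, condEnt, auxL, neg_neg, ← Finset.sum_sub_distrib]
  refine Finset.sum_congr rfl fun s _ => Finset.sum_congr rfl fun a _ => ?_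
  rcases (hQ.1 a s).eq_or_lt with h | h
  · simp [← h]
  · have hSp : 0 < ∑ b, Q b s := lt_of_lt_of_le h (Finset.single_le_sum
      (f := fun b => Q b s) (fun a _ => hQ.1 a s) (Finset.mem_univ a))
    rw [Real.logb_div (by positivity) (hQ.2.2 a s h).ne']
    ring

theorem aux_div_nonneg {𝕏 𝕊 : Type*} [Fintype 𝕏] [Fintype 𝕊] (P Q : 𝕏 → 𝕊 → ℝ)
    (hP0 : ∀ a s, 0 ≤ P a s) (hP1 : ∀ s, ∑ a : 𝕏, P a s = 1)
    (hQ : Q ∈ auxK P) : 0 ≤ condDiv Q P := by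
  rw [aux_div_eq P Q hQ]
  simp only [condEnt, auxL, neg_neg, sub_nonneg]
  exact Finset.sum_le_sum fun s _ => aux_gibbs (fun a => Q a s) (fun a => P a s)
    (fun a => hQ.1 a s) (fun a => hP0 a s) (hP1 s).le (fun a => hQ.2.2 a s)

theorem auxK_compact {𝕏 𝕊 : Type*} [Fintype 𝕏] [Fintype 𝕊] (P : 𝕏 → 𝕊 → ℝ)
    (hP0 : ∀ a s, 0 ≤ P a s) : IsCompact (auxK P) := by
  have hsub : auxK P ⊆ Set.Icc (fun _ _ => 0) (fun _ _ => 1) := by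
    intro Q hQ
    refine ⟨fun a s => hQ.1 a s, fun a s => ?_⟩
    have h1 : Q a s ≤ ∑ b, Q b s := Finset.single_le_sum
      (f := fun b => Q b s) (fun a _ => hQ.1 a s) (Finset.mem_univ a)
    have h2 : ∑ b, Q b s ≤ ∑ s, ∑ b, Q b s := Finset.single_le_sum
      (f := fun s => ∑ b, Q b s) (fun s _ => Finset.sum_nonneg fun a _ => hQ.1 a s)
      (Finset.mem_univ s)
    exact h1.trans (h2.trans hQ.2.1.le)
  refine IsCompact.of_isClosed_subset isCompact_Icc ?_ hsub
  have : auxK P = {Q | ∀ a s, 0 ≤ Q a s} ∩ {Q | ∑ s : 𝕊, ∑ a : 𝕏, Q a s = 1} ∩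
      {Q | ∀ a s, P a s = 0 → Q a s ≤ 0} := by
    ext Q
    constructor
    · rintro ⟨h1, h2, h3⟩
      exact ⟨⟨h1, h2⟩, fun a s h => by
        by_contra hc
        exact (h3 a s (not_le.1 hc)).ne' h⟩
    · rintro ⟨⟨h1, h2⟩, h3⟩
      refine ⟨h1, h2, fun a s h => ?_⟩
      rcases (hP0 a s).eq_or_lt with h' | h'
      · exact absurd (h3 a s h'.symm) (not_le.2 h)
      · exact h'
  rw [this]
  refine (IsClosed.inter ?_ ?_).inter ?_
  · simp only [Set.ofPred_forall]
    exact isClosed_iInter fun a => isClosed_iInter fun s =>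
      isClosed_le continuous_const (by fun_prop)
  · exact isClosed_eq (by fun_prop) continuous_const
  · simp only [Set.ofPred_forall]
    exact isClosed_iInter fun a => isClosed_iInter fun s => isClosed_iInter fun _ =>
      isClosed_le (by fun_prop) continuous_const

theorem auxK_convex {𝕏 𝕊 : Type*} [Fintype 𝕏] [Fintype 𝕊] (P : 𝕏 → 𝕊 → ℝ)
    (hP0 : ∀ a s, 0 ≤ P a s) : Convex ℝ (auxK P) := by
  intro Q1 h1 Q2 h2 c d hc hd hcd
  refine ⟨fun a s => add_nonneg (mul_nonneg hc (h1.1 a s)) (mul_nonneg hd (h2.1 a s)), ?_, ?_⟩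
  · simp only [Pi.add_apply, Pi.smul_apply, smul_eq_mul, Finset.sum_add_distrib,
      ← Finset.mul_sum, h1.2.1, h2.2.1]
    linarith
  · intro a s h
    rcases (hP0 a s).eq_or_lt with h' | h'
    · exfalso
      have e1 : ¬ 0 < Q1 a s := fun hh => (h1.2.2 a s hh).ne h'
      have e2 : ¬ 0 < Q2 a s := fun hh => (h2.2.2 a s hh).ne h'
      have e3 : Q1 a s = 0 := le_antisymm (not_lt.1 e1) (h1.1 a s)
      have e4 : Q2 a s = 0 := le_antisymm (not_lt.1 e2) (h2.1 a s)
      simp [e3, e4] at h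
    · exact h'

theorem auxK_nonempty {𝕏 𝕊 : Type*} [Fintype 𝕏] [Fintype 𝕊] [Nonempty 𝕊] (P : 𝕏 → 𝕊 → ℝ)
    (hP0 : ∀ a s, 0 ≤ P a s) (hP1 : ∀ s, ∑ a : 𝕏, P a s = 1) : (auxK P).Nonempty := by
  have hc : (0 : ℝ) < Fintype.card 𝕊 := by exact_mod_cast Fintype.card_pos
  refine ⟨fun a s => P a s / Fintype.card 𝕊, fun a s => div_nonneg (hP0 a s) hc.le, ?_, ?_⟩
  · simp only [← Finset.sum_div, hP1]
    simp [hc.ne']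
  · intro a s h
    exact (div_pos_iff_of_pos_right hc).1 h

theorem aux_obj_concave {𝕏 𝕊 : Type*} [Fintype 𝕏] [Fintype 𝕊] (P : 𝕏 → 𝕊 → ℝ)
    (hP0 : ∀ a s, 0 ≤ P a s) (θ k : ℝ) (hθ : 0 ≤ θ) :
    ConcaveOn ℝ (auxK P) (fun Q => θ * condEnt Q + k - condDiv Q P) := by
  refine ⟨auxK_convex P hP0, ?_⟩
  intro Q1 h1 Q2 h2 c d hc hd hcd
  have h3 := auxK_convex P hP0 h1 h2 hc hd hcd
  simp only [aux_div_eq P _ h1, aux_div_eq P _ h2, aux_div_eq P _ h3, smul_eq_mul]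
  have hL : auxL P (c • Q1 + d • Q2) = c * auxL P Q1 + d * auxL P Q2 := by
    simp only [auxL, Pi.add_apply, Pi.smul_apply, smul_eq_mul, add_mul, mul_assoc,
      Finset.sum_add_distrib, ← Finset.mul_sum]
  have hH : c * condEnt Q1 + d * condEnt Q2 ≤ condEnt (c • Q1 + d • Q2) := by
    rw [← aux_ent_smul, ← aux_ent_smul]
    exact aux_ent_add _ _ (fun a s => mul_nonneg hc (h1.1 a s))
      (fun a s => mul_nonneg hd (h2.1 a s))
  rw [hL]
  have := mul_le_mul_of_nonneg_left hH (show 0 ≤ 1 + θ by linarith)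
  have hk : k = c * k + d * k := by rw [← add_mul, hcd, one_mul]
  linarith

theorem aux_ent_contK {𝕏 𝕊 : Type*} [Fintype 𝕏] [Fintype 𝕊] (P : 𝕏 → 𝕊 → ℝ) :
    ContinuousOn (condEnt : (𝕏 → 𝕊 → ℝ) → ℝ) (auxK P) :=
  aux_ent_cont.mono fun _ h => h.1

theorem aux_div_contK {𝕏 𝕊 : Type*} [Fintype 𝕏] [Fintype 𝕊] (P : 𝕏 → 𝕊 → ℝ) :
    ContinuousOn (fun Q : 𝕏 → 𝕊 → ℝ => condDiv Q P) (auxK P) := by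
  have hL : Continuous (auxL P) := by unfold auxL; fun_prop
  exact ((aux_ent_contK P).neg.sub hL.continuousOn).congr fun Q hQ => aux_div_eq P Q hQ

theorem stmt_16 {𝕏 𝕊 : Type*} [Fintype 𝕏] [Nonempty 𝕏] [Fintype 𝕊] [Nonempty 𝕊]
    (P : 𝕏 → 𝕊 → ℝ) (hP0 : ∀ a s, 0 ≤ P a s) (hP1 : ∀ s, ∑ a : 𝕏, P a s = 1)
    (ρ : ℝ) (hρ : 0 < ρ)
    (ERρ : ℝ → ℝ)
    (hERρ : ∀ R : ℝ, ERρ R = sSup {v : ℝ | ∃ Q : 𝕏 → 𝕊 → ℝ,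
      (∀ a s, 0 ≤ Q a s) ∧ (∑ s : 𝕊, ∑ a : 𝕏, Q a s = 1) ∧
      (∀ a s, 0 < Q a s → 0 < P a s) ∧
      v = ρ * min (condEnt Q) R - condDiv Q P})
    (E : ℝ → ℝ)
    (hE : ∀ θ : ℝ, E θ = sSup {v : ℝ | ∃ Q : 𝕏 → 𝕊 → ℝ,
      (∀ a s, 0 ≤ Q a s) ∧ (∑ s : 𝕊, ∑ a : 𝕏, Q a s = 1) ∧
      (∀ a s, 0 < Q a s → 0 < P a s) ∧
      v = θ * condEnt Q - condDiv Q P}) :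
    (∀ R : ℝ, 0 < R →
      (∃ Qstar : 𝕏 → 𝕊 → ℝ,
        (∀ a s, 0 ≤ Qstar a s) ∧ (∑ s : 𝕊, ∑ a : 𝕏, Qstar a s = 1) ∧
        (∀ a s, 0 < (∑ b : 𝕏, Qstar b s) →
          Qstar a s / (∑ b : 𝕏, Qstar b s) = P a s) ∧
        R ≤ condEnt Qstar) →
      ERρ R = ρ * R) ∧
    (∀ R : ℝ, 0 < R → ∃ θ₀ ∈ Set.Icc (0 : ℝ) ρ, ERρ R = (ρ - θ₀) * R + E θ₀) ∧
    (∀ e R : ℝ, HasDerivAt E e ρ → e < R → ERρ R = E ρ) := by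
  have hKne := auxK_nonempty P hP0 hP1
  have hKc := auxK_compact P hP0
  have hHc := aux_ent_contK P
  have hDc := aux_div_contK P
  have hDn : ∀ Q ∈ auxK P, 0 ≤ condDiv Q P := fun Q hQ => aux_div_nonneg P Q hP0 hP1 hQ
  -- suprema that are attained
  have hER' : ∀ R, ∀ Q ∈ auxK P,
      (∀ Q' ∈ auxK P, ρ * min (condEnt Q') R - condDiv Q' P
        ≤ ρ * min (condEnt Q) R - condDiv Q P) →
      ERρ R = ρ * min (condEnt Q) R - condDiv Q P := by
    intro R Q hQ hmax
    rw [hERρ]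
    refine IsGreatest.csSup_eq ⟨⟨Q, hQ.1, hQ.2.1, hQ.2.2, rfl⟩, ?_⟩
    rintro v ⟨Q', h1, h2, h3, rfl⟩
    exact hmax Q' ⟨h1, h2, h3⟩
  have hE' : ∀ θ, ∀ Q ∈ auxK P,
      (∀ Q' ∈ auxK P, θ * condEnt Q' - condDiv Q' P ≤ θ * condEnt Q - condDiv Q P) →
      E θ = θ * condEnt Q - condDiv Q P := by
    intro θ Q hQ hmax
    rw [hE]
    refine IsGreatest.csSup_eq ⟨⟨Q, hQ.1, hQ.2.1, hQ.2.2, rfl⟩, ?_⟩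
    rintro v ⟨Q', h1, h2, h3, rfl⟩
    exact hmax Q' ⟨h1, h2, h3⟩
  have hEex : ∀ θ, ∃ Q ∈ auxK P,
      ∀ Q' ∈ auxK P, θ * condEnt Q' - condDiv Q' P ≤ θ * condEnt Q - condDiv Q P := by
    intro θ
    obtain ⟨Q, hQ, hm⟩ := hKc.exists_isMaxOn hKne
      ((continuousOn_const.mul hHc).sub hDc : ContinuousOn
        (fun Q => θ * condEnt Q - condDiv Q P) (auxK P))
    exact ⟨Q, hQ, fun Q' hQ' => hm hQ'⟩
  refine ⟨?_, ?_, ?_⟩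
  · rintro R hR ⟨Q, h1, h2, h3, h4⟩
    have hle : ∀ a s, Q a s ≤ ∑ b, Q b s := fun a s => Finset.single_le_sum
      (f := fun b => Q b s) (fun a _ => h1 a s) (Finset.mem_univ a)
    have hQ : Q ∈ auxK P := by
      refine ⟨h1, h2, fun a s h => ?_⟩
      have hS := lt_of_lt_of_le h (hle a s)
      rw [← h3 a s hS]
      exact div_pos h hS
    have hD : condDiv Q P = 0 := by
      unfold condDiv
      refine Finset.sum_eq_zero fun s _ => Finset.sum_eq_zero fun a _ => ?_
      rcases (h1 a s).eq_or_lt with h | h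
      · simp [← h]
      · have hS := lt_of_lt_of_le h (hle a s)
        rw [h3 a s hS, div_self (hQ.2.2 a s h).ne', Real.logb_one, mul_zero]
    rw [hER' R Q hQ, hD, min_eq_right h4, sub_zero]
    intro Q' hQ'
    rw [hD, min_eq_right h4, sub_zero]
    have := mul_le_mul_of_nonneg_left (min_le_right (condEnt Q') R) hρ.le
    linarith [hDn Q' hQ']
  · intro R hR
    obtain ⟨θ, hθ, Q, hQ, hsad⟩ := Sion.exists_isSaddlePointOn
      (X := Set.Icc (0 : ℝ) ρ) (Y := auxK P)
      (f := fun θ Q => θ * condEnt Q + (ρ - θ) * R - condDiv Q P)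
      ⟨0, le_refl _, hρ.le⟩ (convex_Icc _ _) isCompact_Icc
      (fun Q _ => (Continuous.continuousOn (by fun_prop)).lowerSemicontinuousOn)
      (fun Q _ => by
        refine ConvexOn.quasiconvexOn ⟨convex_Icc _ _, ?_⟩
        intro x _ y _ c d _ _ hcd
        refine le_of_eq ?_
        simp only [smul_eq_mul]
        obtain rfl : d = 1 - c := by linarith
        ring)
      (auxK_convex P hP0) hKne hKc
      (fun θ _ => (((continuousOn_const.mul hHc).add continuousOn_const).sub
        hDc).upperSemicontinuousOn)
      (fun θ hθ => (aux_obj_concave P hP0 θ _ hθ.1).quasiconcaveOn)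
    have hs : ∀ θ' ∈ Set.Icc (0 : ℝ) ρ, ∀ Q' ∈ auxK P,
        θ * condEnt Q' + (ρ - θ) * R - condDiv Q' P
          ≤ θ' * condEnt Q + (ρ - θ') * R - condDiv Q P :=
      fun θ' h' Q' hQ' => hsad θ' h' Q' hQ'
    have hlow : ∀ Q' : 𝕏 → 𝕊 → ℝ, ρ * min (condEnt Q') R ≤ θ * condEnt Q' + (ρ - θ) * R := by
      intro Q'
      have e1 := mul_le_mul_of_nonneg_left (min_le_left (condEnt Q') R) hθ.1
      have e2 := mul_le_mul_of_nonneg_left (min_le_right (condEnt Q') R) (sub_nonneg.2 hθ.2)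
      linarith
    have hupp : ∀ Q' ∈ auxK P, θ * condEnt Q' + (ρ - θ) * R - condDiv Q' P
        ≤ ρ * min (condEnt Q) R - condDiv Q P := by
      intro Q' hQ'
      have e1 := hs 0 ⟨le_refl _, hρ.le⟩ Q' hQ'
      have e2 := hs ρ ⟨hρ.le, le_refl _⟩ Q' hQ'
      rcases min_choice (condEnt Q) R with h | h <;> rw [h] <;> linarith
    refine ⟨θ, hθ, ?_⟩
    rw [hER' R Q hQ (fun Q' hQ' => by linarith [hlow Q', hupp Q' hQ']),
      hE' θ Q hQ (fun Q' hQ' => by linarith [hs θ hθ Q' hQ'])]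
    linarith [hlow Q, hupp Q hQ]
  · intro e R he heR
    obtain ⟨Q, hQ, hmax⟩ := hEex ρ
    have hEρ := hE' ρ Q hQ hmax
    have hmin : IsLocalMin (fun θ => E θ - θ * condEnt Q) ρ := by
      refine Filter.Eventually.of_forall fun θ => ?_
      obtain ⟨Q2, hQ2, hmax2⟩ := hEex θ
      have h1 := hE' θ Q2 hQ2 hmax2
      have h2 := hmax2 Q hQ
      simp only
      linarith
    have hd := hmin.hasDerivAt_eq_zero
      (he.sub ((hasDerivAt_id ρ).mul_const (condEnt Q)))
    have hHR : condEnt Q ≤ R := by linarith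
    rw [hER' R Q hQ, hEρ, min_eq_left hHR]
    intro Q' hQ'
    rw [min_eq_left hHR]
    have := mul_le_mul_of_nonneg_left (min_le_left (condEnt Q') R) hρ.le
    linarith [hmax Q' hQ']

end
end
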